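/- Let n₁,…,n_m ≥ 1, let 2 ≤ r₁,…,r_m < ∞, let Y be an infinite dimensional Banach space, and suppose there is c with 2 ≤ c < ∞ such that Y has cotype c and Y does not have cotype s for any 2 ≤ s < c (i.e., Y has cotype cot Y = c). Then for q > 0: every continuous (n₁,…,n_m)-homogeneous polynomial from ℓ_{r₁} × ⋯ × ℓ_{r_m} into Y is absolutely (q;1)-summing if and only if q ≥ min{1/(n₁/r₁ + ⋯ + n_m/r_m), c}. -/

import Mathlib

open scoped BigOperators

/-- A sequence in a normed space is *weakly 1-summable*. -/
def WeaklySummable (𝕂 : Type*) [RCLike 𝕂] {X : Type*} [NormedAddCommGroup X]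
    [NormedSpace 𝕂 X] (x : ℕ → X) : Prop :=
  ∀ φ : X →L[𝕂] 𝕂, Summable fun j => ‖φ (x j)‖

/-- `P` is a continuous `(n 0, …, n (m-1))`-homogeneous polynomial, i.e. it comes from a
continuous multilinear map in `n 0 + ⋯ + n (m-1)` variables (`n k` copies of `X k`). -/
def IsMultiPoly (𝕂 : Type*) [RCLike 𝕂] {m : ℕ} (n : Fin m → ℕ)
    {X : Fin m → Type*} [∀ k, NormedAddCommGroup (X k)] [∀ k, NormedSpace 𝕂 (X k)]
    {Y : Type*} [NormedAddCommGroup Y] [NormedSpace 𝕂 Y]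
    (P : (∀ k, X k) → Y) : Prop :=
  ∃ T : ContinuousMultilinearMap 𝕂 (fun i : Σ k : Fin m, Fin (n k) => X i.1) Y,
    ∀ x : ∀ k, X k, P x = T fun i => x i.1

/-- A normed space has cotype `q` (Rademacher averages written as an average over signs). -/
def HasCotype (X : Type*) [NormedAddCommGroup X] (q : ℝ) : Prop :=
  ∃ C : ℝ, 0 ≤ C ∧ ∀ (k : ℕ) (x : Fin k → X),
    (∑ j, ‖x j‖ ^ q) ^ (1 / q) ≤
      C * Real.sqrt ((2 ^ k : ℝ)⁻¹ *
        ∑ ε : Fin k → Bool, ‖∑ j, (if ε j then x j else -x j)‖ ^ 2)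

/-- The sign `1` or `-1` attached to a Boolean. -/
def sg (R : Type*) [One R] [Neg R] (b : Bool) : R := if b then 1 else -1

lemma sg_not {R : Type*} [Ring R] (b : Bool) : sg R (!b) = -sg R b := by
  cases b <;> simp [sg]

lemma sg_mul_self {R : Type*} [Ring R] (b : Bool) : sg R b * sg R b = 1 := by
  cases b <;> simp [sg]

lemma norm_sg {R : Type*} [NormedRing R] [NormOneClass R] (b : Bool) : ‖sg R b‖ = 1 := by
  cases b <;> simp [sg]

lemma sg_smul {R M : Type*} [Ring R] [AddCommGroup M] [Module R M] (b : Bool) (x : M) :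
    sg R b • x = if b then x else -x := by
  cases b <;> simp [sg]

/-- Flipping the sign at one place. -/
def flipAt {κ : Type*} [DecidableEq κ] (j : κ) : (κ → Bool) ≃ (κ → Bool) :=
  Function.Involutive.toPerm (fun ε => Function.update ε j (!ε j)) (by
    intro ε; simp)

lemma flipAt_self {κ : Type*} [DecidableEq κ] (j : κ) (ε : κ → Bool) :
    flipAt j ε j = !ε j :=
  Function.update_self ..

lemma flipAt_of_ne {κ : Type*} [DecidableEq κ] {j i : κ} (h : i ≠ j) (ε : κ → Bool) :
    flipAt j ε i = ε i :=
  Function.update_of_ne h ..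

lemma sum_sg_mul_sg {R κ : Type*} [CommRing R] [IsAddTorsionFree R] [Fintype κ] [DecidableEq κ]
    (j k : κ) :
    ∑ ε : κ → Bool, sg R (ε j) * sg R (ε k) = if j = k then 2 ^ Fintype.card κ else 0 := by
  split_ifs with h
  · subst h
    simp [sg_mul_self]
  · have h1 := Equiv.sum_comp (flipAt j) fun ε : κ → Bool => sg R (ε j) * sg R (ε k)
    simp only [flipAt_self, flipAt_of_ne (Ne.symm h), sg_not, neg_mul,
      Finset.sum_neg_distrib] at h1
    exact neg_eq_self.mp h1

/-- The average of a function of signs. -/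
noncomputable def signAvg {κ : Type*} [Fintype κ] [DecidableEq κ] (f : (κ → Bool) → ℝ) : ℝ :=
  ((2 : ℝ) ^ Fintype.card κ)⁻¹ * ∑ ε, f ε

section signAvg

variable {κ : Type*} [Fintype κ] [DecidableEq κ] {f g : (κ → Bool) → ℝ}

lemma signAvg_mono (h : ∀ ε, f ε ≤ g ε) : signAvg f ≤ signAvg g := by
  unfold signAvg
  gcongr
  exact h _

lemma signAvg_const (a : ℝ) : signAvg (fun _ : κ → Bool => a) = a := by
  simp [signAvg]

lemma signAvg_nonneg (h : ∀ ε, 0 ≤ f ε) : 0 ≤ signAvg f := by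
  simpa [signAvg_const] using signAvg_mono h

lemma signAvg_add : signAvg (fun ε => f ε + g ε) = signAvg f + signAvg g := by
  simp only [signAvg, Finset.sum_add_distrib, mul_add]

lemma signAvg_const_mul (a : ℝ) : signAvg (fun ε => a * f ε) = a * signAvg f := by
  simp only [signAvg, ← Finset.mul_sum]; ring

lemma signAvg_comp_equiv (e : (κ → Bool) ≃ (κ → Bool)) :
    signAvg (fun ε => f (e ε)) = signAvg f := by
  simp only [signAvg, Equiv.sum_comp e f]

lemma signAvg_rpow_le (hf : ∀ ε, 0 ≤ f ε) {p : ℝ} (hp : 1 ≤ p) :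
    signAvg f ^ p ≤ signAvg fun ε => f ε ^ p := by
  have := Real.rpow_arith_mean_le_arith_mean_rpow Finset.univ
    (fun _ : κ → Bool => ((2 : ℝ) ^ Fintype.card κ)⁻¹) f (fun _ _ => by positivity)
    (by simp) (fun ε _ => hf ε) hp
  simpa [signAvg, Finset.mul_sum] using this

lemma signAvg_le_sqrt (hf : ∀ ε, 0 ≤ f ε) :
    signAvg f ≤ √(signAvg fun ε => f ε ^ 2) := by
  apply Real.le_sqrt_of_sq_le
  have := signAvg_rpow_le hf (p := 2) (by norm_num)
  simpa using this

lemma exists_le_signAvg (f : (κ → Bool) → ℝ) : ∃ ε, f ε ≤ signAvg f := by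
  by_contra! h
  have : signAvg (fun _ : κ → Bool => signAvg f) < signAvg f := by
    conv_rhs => unfold signAvg
    rw [signAvg]
    gcongr
    exacts [⟨fun _ => true, Finset.mem_univ _⟩, h _]
  rw [signAvg_const] at this
  exact lt_irrefl _ this

lemma signAvg_norm_sq {E : Type*} [NormedAddCommGroup E] [InnerProductSpace ℝ E] (a : κ → E) :
    signAvg (fun ε => ‖∑ j, sg ℝ (ε j) • a j‖ ^ 2) = ∑ j, ‖a j‖ ^ 2 := by
  have h (ε : κ → Bool) : ‖∑ j, sg ℝ (ε j) • a j‖ ^ 2 =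
      ∑ j, ∑ k, (sg ℝ (ε j) * sg ℝ (ε k)) * inner ℝ (a j) (a k) := by
    rw [← real_inner_self_eq_norm_sq, sum_inner]
    refine Finset.sum_congr rfl fun j _ => ?_
    rw [inner_sum]
    refine Finset.sum_congr rfl fun k _ => ?_
    rw [real_inner_smul_left, real_inner_smul_right, mul_assoc]
  simp only [h, signAvg]
  rw [Finset.sum_comm]
  have h2 (j : κ) : ∑ ε : κ → Bool, ∑ k, (sg ℝ (ε j) * sg ℝ (ε k)) * inner ℝ (a j) (a k) =
      2 ^ Fintype.card κ * ‖a j‖ ^ 2 := by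
    rw [Finset.sum_comm]
    simp only [← Finset.sum_mul, sum_sg_mul_sg, ite_mul, zero_mul, Finset.sum_ite_eq,
      Finset.mem_univ, if_true, real_inner_self_eq_norm_sq]
  simp only [h2, ← Finset.mul_sum]
  rw [inv_mul_cancel_left₀ (by positivity)]

end signAvg

lemma HasCotype.exists_const {Y : Type*} [NormedAddCommGroup Y] {c : ℝ} (h : HasCotype Y c)
    (𝕜 : Type*) [RCLike 𝕜] [NormedSpace 𝕜 Y] :
    ∃ C : ℝ, 0 ≤ C ∧ ∀ (κ : Type) [Fintype κ] [DecidableEq κ] (y : κ → Y),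
      (∑ j, ‖y j‖ ^ c) ^ (1 / c) ≤ C * √(signAvg fun ε => ‖∑ j, sg 𝕜 (ε j) • y j‖ ^ 2) := by
  obtain ⟨C, hC, H⟩ := h
  refine ⟨C, hC, fun κ _ _ y => ?_⟩
  let e := (Fintype.equivFin κ).symm
  have := H (Fintype.card κ) (y ∘ e)
  rw [← Equiv.sum_comp e]
  refine this.trans_eq ?_
  congr 2
  unfold signAvg
  congr 1
  rw [← Equiv.sum_comp (e.arrowCongr (Equiv.refl Bool))]
  refine Finset.sum_congr rfl fun ε _ => ?_
  rw [← Equiv.sum_comp e]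
  simp [sg_smul]

lemma WeaklySummable.exists_bound {𝕂 : Type*} [RCLike 𝕂] {X : Type*} [NormedAddCommGroup X]
    [NormedSpace 𝕂 X] {x : ℕ → X} (h : WeaklySummable 𝕂 x) :
    ∃ W : ℝ, ∀ (N : ℕ) (ε : Fin N → 𝕂), (∀ j, ‖ε j‖ ≤ 1) → ‖∑ j, ε j • x j‖ ≤ W := by
  let ι := Σ N : ℕ, {ε : Fin N → 𝕂 // ∀ j, ‖ε j‖ ≤ 1}
  let v : ι → X := fun i => ∑ j, i.2.1 j • x j
  obtain ⟨W, hW⟩ := banach_steinhaus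
    (g := fun i : ι => NormedSpace.inclusionInDoubleDual 𝕂 X (v i)) (by
      intro φ
      refine ⟨∑' j, ‖φ (x j)‖, fun i => ?_⟩
      calc ‖NormedSpace.inclusionInDoubleDual 𝕂 X (v i) φ‖
          = ‖∑ j, i.2.1 j * φ (x j)‖ := by simp [v]
        _ ≤ ∑ j : Fin i.1, ‖φ (x j)‖ := by
          refine (norm_sum_le _ _).trans (Finset.sum_le_sum fun j _ => ?_)
          rw [norm_mul]
          exact mul_le_of_le_one_left (norm_nonneg _) (i.2.2 j)
        _ = ∑ j ∈ Finset.range i.1, ‖φ (x j)‖ := Fin.sum_univ_eq_sum_range (fun j => ‖φ (x j)‖) _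
        _ ≤ ∑' j, ‖φ (x j)‖ := (h φ).sum_le_tsum _ fun _ _ => norm_nonneg _)
  refine ⟨W, fun N ε hε => ?_⟩
  have := hW ⟨N, ε, hε⟩
  rwa [← (NormedSpace.inclusionInDoubleDualLi 𝕂 (E := X)).norm_map]

/-- Sums of values of a multilinear map along the diagonal are controlled by unconditional bounds
for the arguments. The arguments in `s` are frozen. -/
lemma ContinuousMultilinearMap.norm_sum_ite_le {𝕂 : Type*} [RCLike 𝕂] {ι : Type*} [Fintype ι]
    [DecidableEq ι] {X : ι → Type*} [∀ i, NormedAddCommGroup (X i)] [∀ i, NormedSpace 𝕂 (X i)]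
    {Y : Type*} [NormedAddCommGroup Y] [NormedSpace 𝕂 Y] (T : ContinuousMultilinearMap 𝕂 X Y)
    {κ : Type*} [Fintype κ] [DecidableEq κ] (W : ι → ℝ) (n : ℕ) :
    ∀ (s : Finset ι) (_ : sᶜ.card = n) (i₀ : ι) (_ : i₀ ∉ s) (z : ∀ i, X i)
      (_ : ∀ i ∈ s, ‖z i‖ ≤ W i) (x : ∀ i, κ → X i)
      (_ : ∀ i, ∀ ε : κ → 𝕂, (∀ j, ‖ε j‖ ≤ 1) → ‖∑ j, ε j • x i j‖ ≤ W i),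
      ‖∑ j, T fun i => if i ∈ s then z i else x i j‖ ≤ ‖T‖ * ∏ i, W i := by
  induction n with
  | zero =>
    intro s hs i₀ hi₀
    simp_all
  | succ n ih =>
    intro s hs i₀ hi₀ z hz x hx
    by_cases hi : ∃ i₁, i₁ ∉ s ∧ i₁ ≠ i₀
    · obtain ⟨i₁, hi₁, hne⟩ := hi
      let u (ε : κ → Bool) : X i₁ := ∑ k, sg 𝕂 (ε k) • x i₁ k
      let z' (ε : κ → Bool) : ∀ i, X i := Function.update z i₁ (u ε)
      let x' (ε : κ → Bool) : ∀ i, κ → X i :=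
        Function.update x i₀ fun j => sg 𝕂 (ε j) • x i₀ j
      let m (j : κ) : ∀ i, X i := fun i => if i ∈ s then z i else x i j
      have hbound (ε : κ → Bool) :
          ‖∑ j, T fun i => if i ∈ insert i₁ s then z' ε i else x' ε i j‖ ≤ ‖T‖ * ∏ i, W i := by
        apply ih (insert i₁ s) _ i₀ (by simp [hi₀, hne.symm])
        · intro i hi
          by_cases h : i = i₁
          · subst h
            simp only [z', Function.update_self]
            exact hx _ _ fun j => (norm_sg _).le
          · simp only [z', Function.update_of_ne h]
            exact hz _ (Finset.mem_of_mem_insert_of_ne hi h)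
        · intro i δ hδ
          by_cases h : i = i₀
          · subst h
            simp only [x', Function.update_self, smul_smul]
            exact hx _ _ fun j => by simpa [norm_sg] using hδ j
          · simp only [x', Function.update_of_ne h]
            exact hx _ _ hδ
        · rw [Finset.compl_insert, Finset.card_erase_of_mem (by simpa using hi₁), hs]
          simp
      have hexp (ε : κ → Bool) (j : κ) :
          (T fun i => if i ∈ insert i₁ s then z' ε i else x' ε i j) =
            ∑ k, (sg 𝕂 (ε j) * sg 𝕂 (ε k)) • T (Function.update (m j) i₁ (x i₁ k)) := by
        have h1 : (fun i => if i ∈ insert i₁ s then z' ε i else x' ε i j) =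
            Function.update (Function.update (m j) i₁ (u ε)) i₀ (sg 𝕂 (ε j) • x i₀ j) := by
          funext i
          by_cases h : i = i₀
          · subst h
            simp [hi₀, hne.symm, x']
          · by_cases h' : i = i₁
            · subst h'
              simp [h, z']
            · simp [h, h', z', x', m]
        have h2 : Function.update (Function.update (m j) i₁ (u ε)) i₀ (x i₀ j) =
            Function.update (m j) i₁ (u ε) := by
          rw [Function.update_eq_self_iff]
          simp [hne.symm, m, hi₀]
        rw [h1, T.map_update_smul, h2]
        simp only [u]
        have h3 := T.toMultilinearMap.map_update_sum Finset.univ i₁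
          (fun k => sg 𝕂 (ε k) • x i₁ k) (m j)
        simp only [ContinuousMultilinearMap.coe_coe] at h3
        rw [h3, Finset.smul_sum]
        refine Finset.sum_congr rfl fun k _ => ?_
        rw [T.map_update_smul, smul_smul]
      have hsum : ∑ ε : κ → Bool, ∑ j, (T fun i => if i ∈ insert i₁ s then z' ε i else x' ε i j) =
          (2 : 𝕂) ^ Fintype.card κ • ∑ j, T (m j) := by
        rw [Finset.sum_comm, Finset.smul_sum]
        refine Finset.sum_congr rfl fun j _ => ?_
        simp only [hexp]
        rw [Finset.sum_comm]
        simp only [← Finset.sum_smul, sum_sg_mul_sg, ite_smul, zero_smul, Finset.sum_ite_eq,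
          Finset.mem_univ, if_true]
        congr 2
        rw [Function.update_eq_self_iff]
        simp [m, hi₁]
      have h2 : (2 : ℝ) ^ Fintype.card κ * ‖∑ j, T (m j)‖ ≤
          2 ^ Fintype.card κ * (‖T‖ * ∏ i, W i) := by
        calc (2 : ℝ) ^ Fintype.card κ * ‖∑ j, T (m j)‖
            = ‖(2 : 𝕂) ^ Fintype.card κ • ∑ j, T (m j)‖ := by simp [norm_smul]
          _ ≤ ∑ ε : κ → Bool, ‖T‖ * ∏ i, W i := by
            rw [← hsum]
            exact (norm_sum_le _ _).trans (Finset.sum_le_sum fun ε _ => hbound ε)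
          _ = 2 ^ Fintype.card κ * (‖T‖ * ∏ i, W i) := by simp
      exact le_of_mul_le_mul_left h2 (by positivity)
    · push Not at hi
      have h1 (j : κ) : (fun i => if i ∈ s then z i else x i j) =
          Function.update z i₀ (x i₀ j) := by
        funext i
        by_cases h : i = i₀
        · subst h; simp [hi₀]
        · have : i ∈ s := by by_contra h'; exact h (hi i h')
          simp [h, this]
      simp only [h1]
      have h3 := T.toMultilinearMap.map_update_sum Finset.univ i₀ (fun k => x i₀ k) z
      simp only [ContinuousMultilinearMap.coe_coe] at h3
      rw [← h3]
      refine (T.le_opNorm _).trans ?_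
      gcongr with i
      by_cases h : i = i₀
      · subst h
        simpa using hx i (fun _ => 1) (by simp)
      · rw [Function.update_of_ne h]
        exact hz i (by by_contra h'; exact h (hi i h'))

lemma ContinuousMultilinearMap.norm_sum_sg_smul_le {𝕂 : Type*} [RCLike 𝕂] {ι : Type*} [Fintype ι]
    [Nonempty ι] {X : ι → Type*} [∀ i, NormedAddCommGroup (X i)]
    [∀ i, NormedSpace 𝕂 (X i)] {Y : Type*} [NormedAddCommGroup Y] [NormedSpace 𝕂 Y]
    (T : ContinuousMultilinearMap 𝕂 X Y) {κ : Type*} [Fintype κ] (W : ι → ℝ) (x : ∀ i, κ → X i)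
    (hx : ∀ i, ∀ ε : κ → 𝕂, (∀ j, ‖ε j‖ ≤ 1) → ‖∑ j, ε j • x i j‖ ≤ W i) (δ : κ → Bool) :
    ‖∑ j, sg 𝕂 (δ j) • T fun i => x i j‖ ≤ ‖T‖ * ∏ i, W i := by
  classical
  let i₀ : ι := Classical.arbitrary ι
  have := T.norm_sum_ite_le W _ ∅ rfl i₀ (by simp) (fun _ => 0) (by simp)
    (Function.update x i₀ fun j => sg 𝕂 (δ j) • x i₀ j) (by
      intro i ε hε
      by_cases h : i = i₀
      · subst h
        simp only [Function.update_self, smul_smul]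
        exact hx _ _ fun j => by simpa [norm_sg] using hε j
      · simp only [Function.update_of_ne h]
        exact hx _ _ hε)
  refine le_of_eq_of_le ?_ this
  congr 1
  refine Finset.sum_congr rfl fun j _ => ?_
  have h1 : (fun i => if i ∈ (∅ : Finset ι) then (0 : X i) else
      Function.update x i₀ (fun j => sg 𝕂 (δ j) • x i₀ j) i j) =
      Function.update (fun i => x i j) i₀ (sg 𝕂 (δ j) • x i₀ j) := by
    funext i
    by_cases h : i = i₀
    · subst h; simp
    · simp [h]
  rw [h1, T.map_update_smul, Function.update_eq_self]

/-- Multilinear maps into a space of cotype `c` are absolutely `(c; 1)`-summing. -/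
lemma HasCotype.summable_multilinear {𝕂 : Type*} [RCLike 𝕂] {ι : Type*} [Fintype ι]
    [Nonempty ι] {X : ι → Type*} [∀ i, NormedAddCommGroup (X i)]
    [∀ i, NormedSpace 𝕂 (X i)] {Y : Type*} [NormedAddCommGroup Y] [NormedSpace 𝕂 Y] {c : ℝ}
    (hc : 0 < c) (h : HasCotype Y c) (T : ContinuousMultilinearMap 𝕂 X Y) (x : ∀ i, ℕ → X i)
    (hx : ∀ i, WeaklySummable 𝕂 (x i)) : Summable fun j => ‖T fun i => x i j‖ ^ c := by
  obtain ⟨C, hC, H⟩ := h.exists_const 𝕂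
  choose W hW using fun i => (hx i).exists_bound
  have hW0 (i) : 0 ≤ W i := by simpa using hW i 0 0 (by simp)
  have hM : 0 ≤ ‖T‖ * ∏ i, W i := mul_nonneg (norm_nonneg _) (Finset.prod_nonneg fun i _ => hW0 i)
  apply summable_of_sum_range_le (c := (C * (‖T‖ * ∏ i, W i)) ^ c)
  · intro j; positivity
  · intro N
    rw [← Fin.sum_univ_eq_sum_range (fun j => ‖T fun i => x i j‖ ^ c)]
    have h1 := H (Fin N) fun j => T fun i => x i j
    have h2 : √(signAvg fun ε : Fin N → Bool => ‖∑ j, sg 𝕂 (ε j) • T fun i => x i j‖ ^ 2) ≤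
        ‖T‖ * ∏ i, W i := by
      apply Real.sqrt_le_iff.mpr ⟨hM, ?_⟩
      refine (signAvg_mono (g := fun _ => (‖T‖ * ∏ i, W i) ^ 2) fun ε => ?_).trans_eq
        (signAvg_const _)
      gcongr
      exact T.norm_sum_sg_smul_le W (fun i (j : Fin N) => x i j) (fun i => hW i N) ε
    have h3 := h1.trans (mul_le_mul_of_nonneg_left h2 hC)
    have h4 : 0 ≤ ∑ j : Fin N, ‖T fun i => x i j‖ ^ c :=
      Finset.sum_nonneg fun _ _ => by positivity
    calc _ = ((∑ j : Fin N, ‖T fun i => x i j‖ ^ c) ^ (1 / c)) ^ c := by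
          rw [← Real.rpow_mul h4, one_div_mul_cancel hc.ne', Real.rpow_one]
      _ ≤ _ := by gcongr

lemma Summable.rpow_of_le {f : ℕ → ℝ} (hf : ∀ j, 0 ≤ f j) {p q : ℝ} (hp : 0 < p) (hpq : p ≤ q)
    (h : Summable fun j => f j ^ p) : Summable fun j => f j ^ q := by
  refine Summable.of_norm_bounded_eventually_nat h ?_
  filter_upwards [h.tendsto_atTop_zero.eventually_le_const (zero_lt_one)] with j hj
  have h1 : f j ≤ 1 := by
    by_contra! h2
    exact absurd hj (not_le.mpr (Real.one_lt_rpow h2 hp))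
  rw [Real.norm_of_nonneg (Real.rpow_nonneg (hf j) _)]
  rcases (hf j).eq_or_lt with h0 | h0
  · rw [← h0, Real.zero_rpow hp.ne', Real.zero_rpow (hp.trans_le hpq).ne']
  · exact Real.rpow_le_rpow_of_exponent_ge h0 h1 hpq

lemma Real.sum_rpow_le_rpow_sum_of_nonneg {α : Type*} (s : Finset α) {f : α → ℝ}
    (hf : ∀ i, 0 ≤ f i) {p : ℝ} (hp : 1 ≤ p) : ∑ i ∈ s, f i ^ p ≤ (∑ i ∈ s, f i) ^ p := by
  classical
  induction s using Finset.induction_on with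
  | empty => simp [Real.zero_rpow (by linarith : p ≠ 0)]
  | insert a s ha ih =>
    rw [Finset.sum_insert ha, Finset.sum_insert ha]
    exact (add_le_add_right ih _).trans
      (Real.add_rpow_le_rpow_add (hf a) (Finset.sum_nonneg fun i _ => hf i) hp)

lemma sum_norm_rpow_le_signAvg {E : Type*} [NormedAddCommGroup E] [InnerProductSpace ℝ E]
    {κ : Type*} [Fintype κ] [DecidableEq κ] {r : ℝ} (hr : 2 ≤ r) (a : κ → E) :
    ∑ j, ‖a j‖ ^ r ≤ signAvg fun ε => ‖∑ j, sg ℝ (ε j) • a j‖ ^ r := by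
  have hr1 : 1 ≤ r / 2 := by linarith
  have key (x : ℝ) (hx : 0 ≤ x) : x ^ r = (x ^ 2) ^ (r / 2) := by
    rw [← Real.rpow_natCast, ← Real.rpow_mul hx]
    congr 1
    push_cast
    ring
  calc ∑ j, ‖a j‖ ^ r = ∑ j, (‖a j‖ ^ 2) ^ (r / 2) := by simp only [key _ (norm_nonneg _)]
    _ ≤ (∑ j, ‖a j‖ ^ 2) ^ (r / 2) :=
      Real.sum_rpow_le_rpow_sum_of_nonneg _ (fun _ => by positivity) hr1
    _ = (signAvg fun ε => ‖∑ j, sg ℝ (ε j) • a j‖ ^ 2) ^ (r / 2) := by rw [signAvg_norm_sq]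
    _ ≤ signAvg fun ε => (‖∑ j, sg ℝ (ε j) • a j‖ ^ 2) ^ (r / 2) :=
      signAvg_rpow_le (fun _ => by positivity) hr1
    _ = _ := by simp only [← key _ (norm_nonneg _)]

/-- Weakly summable sequences in `ℓ_r`, `2 ≤ r`, are strongly `r`-summable. -/
lemma WeaklySummable.summable_norm_rpow {𝕂 : Type*} [RCLike 𝕂] {r : ℝ} (hr : 2 ≤ r)
    [Fact (1 ≤ ENNReal.ofReal r)] {x : ℕ → lp (fun _ : ℕ => 𝕂) (ENNReal.ofReal r)}
    (hx : WeaklySummable 𝕂 x) : Summable fun j => ‖x j‖ ^ r := by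
  obtain ⟨W, hW⟩ := hx.exists_bound
  have hr0 : (ENNReal.ofReal r).toReal = r := ENNReal.toReal_ofReal (by linarith)
  have hsum (f : lp (fun _ : ℕ => 𝕂) (ENNReal.ofReal r)) :
      HasSum (fun i => ‖f i‖ ^ r) (‖f‖ ^ r) := by
    have := lp.hasSum_norm (p := ENNReal.ofReal r) (by rw [hr0]; linarith) f
    rwa [hr0] at this
  apply summable_of_sum_range_le (c := W ^ r)
  · intro j; positivity
  · intro N
    rw [← Fin.sum_univ_eq_sum_range (fun j => ‖x j‖ ^ r)]
    have h1 : HasSum (fun i => ∑ j : Fin N, ‖x j i‖ ^ r) (∑ j : Fin N, ‖x j‖ ^ r) :=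
      hasSum_sum fun j _ => hsum (x j)
    have h2 : HasSum (fun i => signAvg fun ε : Fin N → Bool =>
        ‖(∑ j, sg 𝕂 (ε j) • x j) i‖ ^ r)
        (signAvg fun ε : Fin N → Bool => ‖∑ j, sg 𝕂 (ε j) • x j‖ ^ r) :=
      (hasSum_sum fun ε _ => hsum _).mul_left _
    refine (hasSum_le (fun i => ?_) h1 h2).trans ?_
    · refine (sum_norm_rpow_le_signAvg hr fun j : Fin N => x j i).trans_eq ?_
      congr 1
      funext ε
      congr 2
      rw [lp.coeFn_sum, Finset.sum_apply]
      refine Finset.sum_congr rfl fun j _ => ?_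
      simp only [sg_smul]
      split_ifs <;> rfl
    · refine (signAvg_mono (g := fun _ => W ^ r) fun ε => ?_).trans_eq (signAvg_const _)
      gcongr
      exact hW N _ fun j => (norm_sg _).le

/-- Weighted Hölder inequality in the form of summability of products. -/
lemma summable_prod_rpow {ι : Type*} [Fintype ι] (w : ι → ℝ) (hw : ∀ i, 0 ≤ w i)
    (hw1 : ∑ i, w i = 1) (f : ι → ℕ → ℝ) (hf : ∀ i j, 0 ≤ f i j) (h : ∀ i, Summable (f i)) :
    Summable fun j => ∏ i, f i j ^ w i := by
  refine Summable.of_nonneg_of_le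
    (fun j => Finset.prod_nonneg fun i _ => Real.rpow_nonneg (hf i j) _)
    (fun j => Real.geom_mean_le_arith_mean_weighted Finset.univ w (fun i => f i j)
      (fun i _ => hw i) hw1 fun i _ => hf i j)
    (summable_sum fun i _ => (h i).mul_left (w i))

lemma summable_multilinear_lp {𝕂 : Type*} [RCLike 𝕂] {ι : Type*} [Fintype ι]
    (r : ι → ℝ) (hr : ∀ i, 2 ≤ r i) [∀ i, Fact (1 ≤ ENNReal.ofReal (r i))]
    {Y : Type*} [NormedAddCommGroup Y] [NormedSpace 𝕂 Y] {l : ℝ} (hl : 0 < l)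
    (hlr : ∑ i, l / r i = 1)
    (T : ContinuousMultilinearMap 𝕂 (fun i => lp (fun _ : ℕ => 𝕂) (ENNReal.ofReal (r i))) Y)
    (x : ∀ i, ℕ → lp (fun _ : ℕ => 𝕂) (ENNReal.ofReal (r i)))
    (hx : ∀ i, WeaklySummable 𝕂 (x i)) : Summable fun j => ‖T fun i => x i j‖ ^ l := by
  have hr0 (i) : 0 < r i := by linarith [hr i]
  have h1 := summable_prod_rpow (fun i => l / r i) (fun i => by have := hr0 i; positivity) hlr
    (fun i j => ‖x i j‖ ^ r i) (fun i j => by positivity)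
    (fun i => (hx i).summable_norm_rpow (hr i))
  refine Summable.of_nonneg_of_le (fun j => by positivity) (fun j => ?_) (h1.mul_left (‖T‖ ^ l))
  calc ‖T fun i => x i j‖ ^ l ≤ (‖T‖ * ∏ i, ‖x i j‖) ^ l := by
        gcongr; exact T.le_opNorm _
    _ = _ := by
      rw [Real.mul_rpow (norm_nonneg _) (by positivity),
        ← Real.finsetProd_rpow _ _ fun i _ => norm_nonneg _]
      congr 1
      refine Finset.prod_congr rfl fun i _ => ?_
      rw [← Real.rpow_mul (norm_nonneg _), mul_div_cancel₀ _ (hr0 i).ne']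

/-- `Y` contains finite families of vectors of norm at least one for which the upper
`ℓ_l`-estimates are much smaller than what `(q; 1)`-summability would force. -/
def HasFlatFamilies (𝕂 : Type*) [RCLike 𝕂] (Y : Type*) [NormedAddCommGroup Y] [NormedSpace 𝕂 Y]
    (q l : ℝ) : Prop :=
  ∀ C : ℝ, ∃ m : ℕ, 0 < m ∧ ∃ y : Fin m → Y, (∀ i, 1 ≤ ‖y i‖) ∧
    ∀ a : Fin m → 𝕂, ∑ i, ‖a i‖ ^ l ≤ 1 → C * ‖∑ i, a i • y i‖ ≤ (m : ℝ) ^ (1 / q - 1 / l)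

lemma ContinuousMultilinearMap.opNorm_le_of_unit_balls {𝕂 : Type*} [RCLike 𝕂] {ι : Type*}
    [Fintype ι] {X : ι → Type*} [∀ i, NormedAddCommGroup (X i)] [∀ i, NormedSpace 𝕂 (X i)]
    {Y : Type*} [NormedAddCommGroup Y] [NormedSpace 𝕂 Y] (T : ContinuousMultilinearMap 𝕂 X Y)
    {M : ℝ} (hM : 0 ≤ M) (h : ∀ z, (∀ i, ‖z i‖ ≤ 1) → ‖T z‖ ≤ M) : ‖T‖ ≤ M := by
  refine ContinuousMultilinearMap.opNorm_le_bound hM fun z => ?_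
  by_cases hz : ∃ i, z i = 0
  · obtain ⟨i, hi⟩ := hz
    rw [T.map_coord_zero i hi, norm_zero]
    positivity
  · push Not at hz
    have h1 : z = fun i => (‖z i‖ : 𝕂) • ((‖z i‖ : 𝕂)⁻¹ • z i) := by
      funext i
      rw [smul_inv_smul₀]
      simpa using hz i
    have h2 := h (fun i => (‖z i‖ : 𝕂)⁻¹ • z i) fun i => by
      rw [norm_smul, norm_inv, RCLike.norm_ofReal, abs_norm,
        inv_mul_cancel₀ (norm_ne_zero_iff.mpr (hz i))]
    have h3 : T z = (∏ i, (‖z i‖ : 𝕂)) • T fun i => (‖z i‖ : 𝕂)⁻¹ • z i := by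
      conv_lhs => rw [h1]
      exact T.map_smul_univ _ _
    rw [h3, norm_smul, norm_prod, mul_comm]
    simp only [RCLike.norm_ofReal, abs_norm]
    gcongr

lemma weaklySummable_single {𝕂 : Type*} [RCLike 𝕂] {r : ℝ} (hr : 1 ≤ r)
    [Fact (1 ≤ ENNReal.ofReal r)] {a : ℕ → 𝕂} (ha : Summable fun j => ‖a j‖ ^ r) :
    WeaklySummable 𝕂 fun j =>
      (lp.single (E := fun _ : ℕ => 𝕂) (ENNReal.ofReal r) j (a j) :
        lp (fun _ : ℕ => 𝕂) (ENNReal.ofReal r)) := by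
  intro φ
  have hr0 : (ENNReal.ofReal r).toReal = r := ENNReal.toReal_ofReal (by linarith)
  choose θ hθ hθ' using fun j => RCLike.exists_norm_eq_mul_self
    (φ (lp.single (E := fun _ : ℕ => 𝕂) (ENNReal.ofReal r) j (a j)))
  apply summable_of_sum_range_le (c := ‖φ‖ * (∑' j, ‖a j‖ ^ r) ^ (1 / r))
  · intro j; positivity
  · intro N
    have h1 : ((∑ j ∈ Finset.range N,
        ‖φ (lp.single (E := fun _ : ℕ => 𝕂) (ENNReal.ofReal r) j (a j))‖ : ℝ) : 𝕂) =
        φ (∑ j ∈ Finset.range N,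
          lp.single (E := fun _ : ℕ => 𝕂) (ENNReal.ofReal r) j (θ j * a j)) := by
      push_cast
      rw [map_sum]
      refine Finset.sum_congr rfl fun j _ => ?_
      refine (hθ' j).trans ?_
      rw [← smul_eq_mul (θ j) (a j), lp.single_smul, map_smul, smul_eq_mul]
    have h2 : ∑ j ∈ Finset.range N,
        ‖φ (lp.single (E := fun _ : ℕ => 𝕂) (ENNReal.ofReal r) j (a j))‖ =
        ‖φ (∑ j ∈ Finset.range N,
          lp.single (E := fun _ : ℕ => 𝕂) (ENNReal.ofReal r) j (θ j * a j))‖ := by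
      rw [← h1, RCLike.norm_ofReal, abs_of_nonneg (Finset.sum_nonneg fun _ _ => norm_nonneg _)]
    rw [h2]
    refine (φ.le_opNorm _).trans ?_
    gcongr
    have h3 := lp.norm_sum_single (p := ENNReal.ofReal r) (E := fun _ : ℕ => 𝕂)
      (by rw [hr0]; linarith)
      (fun j => θ j * a j) (Finset.range N)
    rw [hr0] at h3
    have h4 : ‖∑ j ∈ Finset.range N, lp.single (E := fun _ : ℕ => 𝕂) (ENNReal.ofReal r) j
        (θ j * a j)‖ ^ r ≤ ∑' j, ‖a j‖ ^ r := by
      rw [h3]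
      simp only [norm_mul, hθ, one_mul]
      exact ha.sum_le_tsum _ fun _ _ => by positivity
    calc _ = (‖∑ j ∈ Finset.range N, lp.single (E := fun _ : ℕ => 𝕂) (ENNReal.ofReal r) j
        (θ j * a j)‖ ^ r) ^ (1 / r) := by
          rw [← Real.rpow_mul (norm_nonneg _), mul_one_div_cancel (by linarith), Real.rpow_one]
      _ ≤ _ := by gcongr

/-- The diagonal multilinear map on sequence spaces with values in the span of finitely many
vectors. -/
noncomputable def diagMap (𝕂 : Type*) [RCLike 𝕂] {ι : Type*} [Fintype ι] (r : ι → ℝ)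
    [∀ i, Fact (1 ≤ ENNReal.ofReal (r i))] {Y : Type*} [NormedAddCommGroup Y] [NormedSpace 𝕂 Y]
    {m : ℕ} (p : Fin m → ℕ) (y : Fin m → Y) :
    ContinuousMultilinearMap 𝕂 (fun i => lp (fun _ : ℕ => 𝕂) (ENNReal.ofReal (r i))) Y :=
  ∑ s, ((ContinuousMultilinearMap.mkPiAlgebra 𝕂 ι 𝕂).compContinuousLinearMap
    fun i => lp.evalCLM 𝕂 (fun _ : ℕ => 𝕂) (ENNReal.ofReal (r i)) (p s)).smulRight (y s)

section diagMap

variable {𝕂 : Type*} [RCLike 𝕂] {ι : Type*} [Fintype ι] {r : ι → ℝ}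
    [∀ i, Fact (1 ≤ ENNReal.ofReal (r i))] {Y : Type*} [NormedAddCommGroup Y] [NormedSpace 𝕂 Y]
    {m : ℕ} {p : Fin m → ℕ} {y : Fin m → Y}

lemma diagMap_apply (z : ∀ i, lp (fun _ : ℕ => 𝕂) (ENNReal.ofReal (r i))) :
    diagMap 𝕂 r p y z = ∑ s, (∏ i, z i (p s)) • y s := by
  simp [diagMap, lp.evalCLM]

lemma norm_diagMap_le (hr : ∀ i, 1 ≤ r i) {l : ℝ} (hl : 0 < l) (hlr : ∑ i, l / r i = 1)
    (hp : Function.Injective p) {M : ℝ} (hM : 0 ≤ M)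
    (h : ∀ a : Fin m → 𝕂, ∑ s, ‖a s‖ ^ l ≤ 1 → ‖∑ s, a s • y s‖ ≤ M) :
    ‖diagMap 𝕂 r p y‖ ≤ M := by
  refine ContinuousMultilinearMap.opNorm_le_of_unit_balls _ hM fun z hz => ?_
  rw [diagMap_apply]
  have hr0 (i) : 0 < r i := by linarith [hr i]
  apply h
  have h1 (s : Fin m) : ‖∏ i, z i (p s)‖ ^ l ≤ ∑ i, l / r i * ‖z i (p s)‖ ^ r i := by
    refine le_of_eq_of_le ?_ (Real.geom_mean_le_arith_mean_weighted Finset.univ (fun i => l / r i)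
      (fun i => ‖z i (p s)‖ ^ r i) (fun i _ => by have := hr0 i; positivity) hlr
      fun i _ => by positivity)
    rw [norm_prod, ← Real.finsetProd_rpow _ _ fun i _ => norm_nonneg _]
    refine Finset.prod_congr rfl fun i _ => ?_
    rw [← Real.rpow_mul (norm_nonneg _), mul_div_cancel₀ _ (hr0 i).ne']
  calc ∑ s, ‖∏ i, z i (p s)‖ ^ l ≤ ∑ s, ∑ i, l / r i * ‖z i (p s)‖ ^ r i :=
        Finset.sum_le_sum fun s _ => h1 s
    _ = ∑ i, l / r i * ∑ s, ‖z i (p s)‖ ^ r i := by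
        rw [Finset.sum_comm]; simp only [Finset.mul_sum]
    _ ≤ ∑ i, l / r i * 1 := by
        refine Finset.sum_le_sum fun i _ => ?_
        have := hr0 i
        gcongr
        have hri : (ENNReal.ofReal (r i)).toReal = r i := ENNReal.toReal_ofReal this.le
        have h2 := lp.sum_rpow_le_norm_rpow (by rw [hri]; exact this) (z i)
          (Finset.univ.map ⟨p, hp⟩)
        rw [hri, Finset.sum_map] at h2
        exact h2.trans (Real.rpow_le_one (norm_nonneg _) (hz i) this.le)
    _ = 1 := by simpa using hlr

end diagMap

lemma HasFlatFamilies.exists_not_summable {𝕂 : Type*} [RCLike 𝕂] {ι : Type*} [Fintype ι]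
    [Nonempty ι] {r : ι → ℝ} (hr : ∀ i, 1 ≤ r i) [∀ i, Fact (1 ≤ ENNReal.ofReal (r i))]
    {Y : Type*} [NormedAddCommGroup Y] [NormedSpace 𝕂 Y] [CompleteSpace Y] {q l : ℝ} (hq : 0 < q)
    (hl : 0 < l) (hlr : ∑ i, l / r i = 1) (H : HasFlatFamilies 𝕂 Y q l) :
    ∃ (T : ContinuousMultilinearMap 𝕂 (fun i => lp (fun _ : ℕ => 𝕂) (ENNReal.ofReal (r i))) Y)
      (b : ℕ → ℝ), (∀ j, 0 ≤ b j) ∧ (Summable fun j => b j ^ l) ∧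
      ¬Summable fun j => ‖T fun i =>
        lp.single (ENNReal.ofReal (r i)) j ((b j ^ (l / r i) : ℝ) : 𝕂)‖ ^ q := by
  have hr0 (i) : 0 < r i := by linarith [hr i]
  choose m hm y hy hay using fun k : ℕ => H (4 ^ k * (2 ^ k) ^ (1 / l))
  have hm' (k) : (0 : ℝ) < m k := by exact_mod_cast hm k
  let S := Σ k, Fin (m k)
  have : Infinite S := Infinite.of_injective (fun k => (⟨k, ⟨0, hm k⟩⟩ : S)) fun a b h => by
    simpa using congrArg Sigma.fst h
  obtain ⟨hden⟩ := nonempty_denumerable S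
  let e : S ≃ ℕ := Denumerable.eqv S
  let D (k : ℕ) : ℝ := (m k : ℝ) ^ (1 / q - 1 / l)
  have hD (k) : 0 < D k := Real.rpow_pos_of_pos (hm' k) _
  let α (k : ℕ) : ℝ := (2 ^ k) ^ (1 / l) * 2 ^ k / D k
  have hα (k) : 0 < α k := by have := hD k; positivity
  let T (k : ℕ) := diagMap 𝕂 r (fun s : Fin (m k) => e ⟨k, s⟩) fun s => (α k : 𝕂) • y k s
  have hT (k) : ‖T k‖ ≤ (1 / 2) ^ k := by
    refine norm_diagMap_le hr hl hlr ?_ (by positivity) fun a ha => ?_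
    · intro s t h
      exact sigma_mk_injective (β := fun k => Fin (m k)) (e.injective h)
    · have h1 := hay k a ha
      have h2 : ‖∑ s, a s • (α k : 𝕂) • y k s‖ = α k * ‖∑ s, a s • y k s‖ := by
        simp only [smul_comm (a _) (α k : 𝕂)]
        rw [← Finset.smul_sum, norm_smul, RCLike.norm_ofReal, abs_of_pos (hα k)]
      have h4 : (4 : ℝ) ^ k = 2 ^ k * 2 ^ k := by rw [← mul_pow]; norm_num
      rw [h4] at h1
      rw [h2, one_div, inv_pow, ← one_div, le_div_iff₀ (by positivity)]
      calc α k * ‖∑ s, a s • y k s‖ * 2 ^ k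
          = (2 ^ k * 2 ^ k * (2 ^ k) ^ (1 / l) * ‖∑ s, a s • y k s‖) / D k := by
            simp only [α]; ring
        _ ≤ D k / D k := by
            have := hD k
            gcongr
        _ = 1 := div_self (hD k).ne'
  have hTs : Summable T := Summable.of_norm_bounded summable_geometric_two hT
  let b' (s : S) : ℝ := (((2 : ℝ) ^ s.1 * (m s.1 : ℝ))⁻¹) ^ (1 / l)
  have hb' (s) : 0 < b' s := by have := hm' s.1; positivity
  refine ⟨∑' k, T k, fun j => b' (e.symm j), fun j => (hb' _).le, ?_, ?_⟩
  · rw [← e.summable_iff]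
    have h1 : ((fun j => b' (e.symm j) ^ l) ∘ e) =
        fun s : S => ((2 : ℝ) ^ s.1 * (m s.1 : ℝ))⁻¹ := by
      funext s
      have := hm' s.1
      simp only [Function.comp, Equiv.symm_apply_apply, b']
      rw [← Real.rpow_mul (by positivity), one_div_mul_cancel hl.ne', Real.rpow_one]
    rw [h1, summable_sigma_of_nonneg fun s => by positivity]
    refine ⟨fun k => Summable.of_finite, ?_⟩
    refine summable_geometric_two.congr fun k => ?_
    have := hm' k
    rw [tsum_fintype]
    simp
    field_simp
  · intro hsum
    rw [← e.summable_iff] at hsum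
    have h2 := hsum.sigma.tendsto_atTop_zero
    have h3 := h2.eventually_lt_const (zero_lt_one)
    obtain ⟨k, hk⟩ := h3.exists
    refine absurd hk (not_lt.mpr ?_)
    have hval (s : Fin (m k)) : ‖(∑' k, T k) fun i => lp.single (ENNReal.ofReal (r i)) (e ⟨k, s⟩)
        ((b' ⟨k, s⟩ ^ (l / r i) : ℝ) : 𝕂)‖ = b' ⟨k, s⟩ * (α k * ‖y k s‖) := by
      rw [ContinuousMultilinearMap.tsum_eval hTs, tsum_eq_single k, diagMap_apply,
        Finset.sum_eq_single s]
      · simp only [lp.single_apply_self]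
        rw [← RCLike.ofReal_prod, ← Real.rpow_sum_of_pos (hb' _), hlr, Real.rpow_one, norm_smul,
          norm_smul, RCLike.norm_ofReal, RCLike.norm_ofReal, abs_of_pos (hb' _), abs_of_pos (hα k)]
      · intro t _ hts
        rw [Finset.prod_eq_zero (Finset.mem_univ (Classical.arbitrary ι)), zero_smul]
        apply lp.single_apply_ne
        exact fun h => hts (sigma_mk_injective (β := fun k => Fin (m k)) (e.injective h))
      · simp
      · intro k' hk'
        rw [diagMap_apply]
        refine Finset.sum_eq_zero fun t _ => ?_
        rw [Finset.prod_eq_zero (Finset.mem_univ (Classical.arbitrary ι)), zero_smul]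
        apply lp.single_apply_ne
        intro h
        exact hk' (congrArg Sigma.fst (e.injective h))
    simp only [Function.comp, Equiv.symm_apply_apply, hval, tsum_fintype]
    have h5 (s : Fin (m k)) : (m k : ℝ)⁻¹ ≤ (b' ⟨k, s⟩ * (α k * ‖y k s‖)) ^ q := by
      have h6 : ((m k : ℝ)⁻¹) ^ (1 / q) ≤ b' ⟨k, s⟩ * (α k * ‖y k s‖) := by
        have h7 : b' ⟨k, s⟩ * α k = 2 ^ k * ((m k : ℝ)⁻¹) ^ (1 / q) := by
          simp only [b', α, D]
          rw [Real.inv_rpow (by positivity), Real.mul_rpow (by positivity) (by positivity),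
            Real.rpow_sub (hm' k), Real.inv_rpow (by positivity)]
          have := hm' k
          field_simp
        calc ((m k : ℝ)⁻¹) ^ (1 / q) ≤ b' ⟨k, s⟩ * α k := by
              rw [h7]
              exact le_mul_of_one_le_left (by positivity) (one_le_pow₀ (by norm_num))
          _ ≤ b' ⟨k, s⟩ * α k * ‖y k s‖ :=
              le_mul_of_one_le_right (mul_pos (hb' _) (hα k)).le (hy k s)
          _ = _ := mul_assoc _ _ _
      calc (m k : ℝ)⁻¹ = (((m k : ℝ)⁻¹) ^ (1 / q)) ^ q := by
            rw [← Real.rpow_mul (by positivity), one_div_mul_cancel hq.ne', Real.rpow_one]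
        _ ≤ _ := by gcongr
    calc (1 : ℝ) = ∑ s : Fin (m k), (m k : ℝ)⁻¹ := by simp [(hm' k).ne']
      _ ≤ _ := Finset.sum_le_sum fun s _ => h5 s

lemma HasFlatFamilies.of_real {𝕂 : Type*} [RCLike 𝕂] {Y : Type*} [NormedAddCommGroup Y]
    [NormedSpace ℝ Y] [NormedSpace 𝕂 Y] [IsScalarTower ℝ 𝕂 Y] {q l : ℝ} (hl : 0 < l)
    (H : HasFlatFamilies ℝ Y q l) : HasFlatFamilies 𝕂 Y q l := by
  intro C
  obtain ⟨m, hm, y, hy, h⟩ := H (2 * |C|)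
  refine ⟨m, hm, y, hy, fun a ha => ?_⟩
  have h1 : ∑ i, a i • y i = ∑ i, RCLike.re (a i) • y i +
      (RCLike.I : 𝕂) • ∑ i, RCLike.im (a i) • y i := by
    rw [Finset.smul_sum, ← Finset.sum_add_distrib]
    refine Finset.sum_congr rfl fun i _ => ?_
    conv_lhs => rw [← RCLike.re_add_im (a i)]
    rw [add_smul, mul_comm, mul_smul, ← RCLike.real_smul_eq_coe_smul,
      ← RCLike.real_smul_eq_coe_smul]
  have h2 := h (fun i => RCLike.re (a i)) (le_trans (by
    gcongr with i; exact RCLike.norm_re_le_norm _) ha)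
  have h3 := h (fun i => RCLike.im (a i)) (le_trans (by
    gcongr with i; exact RCLike.norm_im_le_norm _) ha)
  have h4 : ‖∑ i, a i • y i‖ ≤ ‖∑ i, RCLike.re (a i) • y i‖ + ‖∑ i, RCLike.im (a i) • y i‖ := by
    rw [h1]
    refine (norm_add_le _ _).trans ?_
    gcongr
    rw [norm_smul]
    refine mul_le_of_le_one_left (norm_nonneg _) ?_
    rcases eq_or_ne (RCLike.I : 𝕂) 0 with hI | hI
    · simp [hI]
    · rw [RCLike.norm_I_of_ne_zero hI]
  calc C * ‖∑ i, a i • y i‖ ≤ |C| * ‖∑ i, a i • y i‖ := by gcongr; exact le_abs_self C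
    _ ≤ |C| * (‖∑ i, RCLike.re (a i) • y i‖ + ‖∑ i, RCLike.im (a i) • y i‖) := by gcongr
    _ ≤ _ := by linarith

lemma HasFlatFamilies.of_upper_estimate {𝕂 : Type*} [RCLike 𝕂] {Y : Type*} [NormedAddCommGroup Y]
    [NormedSpace 𝕂 Y] {q l s K : ℝ} (hq : 0 < q) (hqs : q < s)
    (H : ∀ N : ℕ, ∃ m : ℕ, N ≤ m ∧ ∃ y : Fin m → Y, (∀ i, 1 ≤ ‖y i‖) ∧
      ∀ a : Fin m → 𝕂, ∑ i, ‖a i‖ ^ l ≤ 1 → ‖∑ i, a i • y i‖ ≤ K * (m : ℝ) ^ (1 / s - 1 / l)) :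
    HasFlatFamilies 𝕂 Y q l := by
  intro C
  have hpos : 0 < 1 / q - 1 / s := sub_pos.mpr (one_div_lt_one_div_of_lt hq hqs)
  have ht : Filter.Tendsto (fun m : ℕ => (m : ℝ) ^ (1 / q - 1 / s)) Filter.atTop Filter.atTop :=
    (tendsto_rpow_atTop hpos).comp tendsto_natCast_atTop_atTop
  obtain ⟨N, hN⟩ := Filter.eventually_atTop.mp (ht.eventually_ge_atTop (|C| * K))
  obtain ⟨m, hm, y, hy, h⟩ := H (max N 1)
  have hm0 : (0 : ℝ) < m := by
    have : 1 ≤ m := (le_max_right _ _).trans hm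
    exact_mod_cast this
  refine ⟨m, by exact_mod_cast hm0, y, hy, fun a ha => ?_⟩
  calc C * ‖∑ i, a i • y i‖ ≤ |C| * ‖∑ i, a i • y i‖ := by gcongr; exact le_abs_self C
    _ ≤ |C| * (K * (m : ℝ) ^ (1 / s - 1 / l)) := by gcongr; exact h a ha
    _ = |C| * K * (m : ℝ) ^ (1 / s - 1 / l) := by ring
    _ ≤ (m : ℝ) ^ (1 / q - 1 / s) * (m : ℝ) ^ (1 / s - 1 / l) := by
        gcongr
        exact hN m ((le_max_left _ _).trans hm)
    _ = _ := by rw [← Real.rpow_add hm0]; ring_nf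

lemma sum_rpow_le_one_of_le {κ : Type*} [Fintype κ] {p t : ℝ} (hp : 0 < p) (hpt : p ≤ t)
    {a : κ → ℝ} (ha0 : ∀ i, 0 ≤ a i) (ha : ∑ i, a i ^ p ≤ 1) : ∑ i, a i ^ t ≤ 1 := by
  refine le_trans ?_ ha
  refine Finset.sum_le_sum fun i _ => ?_
  have h1 : a i ^ p ≤ 1 := (Finset.single_le_sum (f := fun i => a i ^ p)
    (fun i _ => Real.rpow_nonneg (ha0 i) _) (Finset.mem_univ i)).trans ha
  have h2 : a i ≤ 1 := by
    by_contra! h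
    exact absurd h1 (not_le.mpr (Real.one_lt_rpow h hp))
  rcases (ha0 i).eq_or_lt with h | h
  · rw [← h, Real.zero_rpow hp.ne', Real.zero_rpow (by linarith)]
  · exact Real.rpow_le_rpow_of_exponent_ge h h2 hpt

lemma sum_rpow_le_card_rpow {κ : Type*} [Fintype κ] {p t : ℝ} (ht : 0 < t) (htp : t < p)
    {a : κ → ℝ} (ha0 : ∀ i, 0 ≤ a i) (ha : ∑ i, a i ^ p ≤ 1) :
    ∑ i, a i ^ t ≤ (Fintype.card κ : ℝ) ^ (1 - t / p) := by
  have hp : 0 < p := ht.trans htp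
  have hpt : 1 < p / t := (one_lt_div ht).mpr htp
  have h1 := Real.inner_le_Lp_mul_Lq_of_nonneg Finset.univ
    (f := fun i => a i ^ t) (g := fun _ => 1)
    (Real.HolderConjugate.conjExponent hpt)
    (fun i _ => Real.rpow_nonneg (ha0 i) _) (fun _ _ => zero_le_one)
  have h2 : 1 / (p / t).conjExponent = 1 - t / p := by
    rw [Real.conjExponent]; field_simp
  have h3 (i : κ) : (a i ^ t) ^ (p / t) = a i ^ p := by
    rw [← Real.rpow_mul (ha0 i), mul_div_cancel₀ _ ht.ne']
  simp only [mul_one, h3, Real.one_rpow, Finset.sum_const, Finset.card_univ, nsmul_eq_mul, h2] at h1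
  refine h1.trans ?_
  exact mul_le_of_le_one_left (by positivity)
    (Real.rpow_le_one (Finset.sum_nonneg fun i _ => Real.rpow_nonneg (ha0 i) _) ha (by positivity))

lemma LinearMap.IsProj.det_id_add {V : Type*} [AddCommGroup V] [Module ℝ V]
    [FiniteDimensional ℝ V] {W : Submodule ℝ V} {P : V →ₗ[ℝ] V} (h : LinearMap.IsProj W P) :
    LinearMap.det (LinearMap.id + P) = 2 ^ Module.finrank ℝ W := by
  have h1 : LinearMap.id + P = (W.prodEquivOfIsCompl (LinearMap.ker P) h.isCompl).conj
      (LinearMap.prodMap ((2 : ℝ) • LinearMap.id) LinearMap.id) := by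
    conv_lhs => rw [h.eq_conj_prodMap, ← LinearEquiv.conj_id
      (W.prodEquivOfIsCompl (LinearMap.ker P) h.isCompl), ← map_add]
    congr 1
    ext <;> simp [two_smul]
  rw [h1, LinearEquiv.conj_apply, LinearMap.comp_assoc]
  rw [LinearMap.det_conj, LinearMap.det_prodMap]
  simp

lemma exists_half_norm_lt {E Y : Type*} [NormedAddCommGroup E] [InnerProductSpace ℝ E]
    [FiniteDimensional ℝ E] [Nontrivial E] [NormedAddCommGroup Y] [NormedSpace ℝ Y]
    (L : E →ₗ[ℝ] Y) (hL : LinearMap.ker L = ⊥) :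
    ∃ A : E →L[ℝ] E, (∀ x, ‖L (A x)‖ ≤ ‖x‖) ∧ ∀ W : Submodule ℝ E,
      Module.finrank ℝ E ≤ 2 * Module.finrank ℝ W → ∃ x ∈ W, 1 / 4 * ‖x‖ < ‖L (A x)‖ := by
  obtain ⟨K, hK, hLK⟩ := L.exists_antilipschitzWith hL
  have hLc : Continuous L := L.continuous_of_finiteDimensional
  set S : Set (E →L[ℝ] E) := {A | ∀ x, ‖L (A x)‖ ≤ ‖x‖} with hS
  have hSc : IsClosed S := by
    simp only [hS, Set.ofPred_forall]
    refine isClosed_iInter fun x => isClosed_le ?_ continuous_const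
    exact (hLc.comp (ContinuousLinearMap.apply ℝ E x).continuous).norm
  have hSb : Bornology.IsBounded S := by
    refine isBounded_iff_forall_norm_le.mpr ⟨K, fun A hA => ?_⟩
    refine A.opNorm_le_bound K.2 fun x => ?_
    have := hLK.le_mul_dist (A x) 0
    simp only [map_zero, dist_zero_right] at this
    exact this.trans (mul_le_mul_of_nonneg_left (hA x) K.2)
  have : ProperSpace (E →L[ℝ] E) := FiniteDimensional.proper ℝ _
  have hcomp : IsCompact S := Metric.isCompact_of_isClosed_isBounded hSc hSb
  obtain ⟨M, hM0, hM⟩ : ∃ M : ℝ, 0 < M ∧ ∀ x, ‖L x‖ ≤ M * ‖x‖ := by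
    let L' := LinearMap.toContinuousLinearMap L
    refine ⟨‖L'‖ + 1, by positivity, fun x => (L'.le_opNorm x).trans ?_⟩
    gcongr
    linarith
  have hid : M⁻¹ • ContinuousLinearMap.id ℝ E ∈ S := by
    intro x
    simp only [smul_apply, ContinuousLinearMap.id_apply, map_smul, norm_smul,
      norm_inv, Real.norm_of_nonneg hM0.le]
    rw [inv_mul_le_iff₀ hM0]
    exact hM x
  obtain ⟨A, hAS, hA⟩ := hcomp.exists_isMaxOn ⟨_, hid⟩
    (f := fun A : E →L[ℝ] E => |A.det|) (ContinuousLinearMap.continuous_det.abs.continuousOn)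
  refine ⟨A, hAS, fun W hW => ?_⟩
  by_contra! hcon
  have hdet : 0 < |A.det| := by
    refine lt_of_lt_of_le ?_ (hA hid)
    simp only [ContinuousLinearMap.det, ContinuousLinearMap.toLinearMap_smul, LinearMap.det_smul]
    simp [abs_pos, hM0.ne']
  set B : E →L[ℝ] E := (4 / 5 : ℝ) • A.comp (ContinuousLinearMap.id ℝ E + W.starProjection) with hB
  have hBS : B ∈ S := by
    intro x
    have h1 : ‖L (A (W.starProjection x))‖ ≤ 1 / 4 * ‖x‖ := by
      refine (hcon _ (W.starProjection_apply_mem x)).trans ?_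
      gcongr
      exact W.norm_starProjection_apply_le x
    have h2 : L (B x) = (4 / 5 : ℝ) • (L (A x) + L (A (W.starProjection x))) := by
      simp [hB]
    rw [h2, norm_smul, Real.norm_of_nonneg (by norm_num)]
    have := norm_add_le (L (A x)) (L (A (W.starProjection x)))
    have := hAS x
    linarith
  have h3 : |B.det| = |A.det| * ((4 / 5 : ℝ) ^ Module.finrank ℝ E * 2 ^ Module.finrank ℝ W) := by
    have hproj : LinearMap.IsProj W (W.starProjection : E →ₗ[ℝ] E) :=
      ⟨fun x => W.starProjection_apply_mem x, fun x hx =>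
        Submodule.starProjection_eq_self_iff.mpr hx⟩
    have h4 : (B : E →ₗ[ℝ] E) = (4 / 5 : ℝ) • ((A : E →ₗ[ℝ] E) ∘ₗ
        (LinearMap.id + (W.starProjection : E →ₗ[ℝ] E))) := by
      ext x; simp [hB]
    have h5 : B.det = (4 / 5 : ℝ) ^ Module.finrank ℝ E * (A.det * 2 ^ Module.finrank ℝ W) := by
      rw [ContinuousLinearMap.det, h4, LinearMap.det_smul, LinearMap.det_comp, hproj.det_id_add]
    rw [h5, abs_mul, abs_mul, abs_of_pos (by positivity : (0 : ℝ) < (4 / 5) ^ _),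
      abs_of_pos (by positivity : (0 : ℝ) < 2 ^ _)]
    ring
  have h5 : 1 < (4 / 5 : ℝ) ^ Module.finrank ℝ E * 2 ^ Module.finrank ℝ W := by
    have h6 : ((4 / 5 : ℝ) ^ Module.finrank ℝ E * 2 ^ Module.finrank ℝ W) ^ 2 =
        (16 / 25) ^ Module.finrank ℝ E * 2 ^ (2 * Module.finrank ℝ W) := by
      rw [mul_pow, ← pow_mul, ← pow_mul, mul_comm _ 2, pow_mul, mul_comm _ 2]
      norm_num
    have h7 : (1 : ℝ) < (16 / 25) ^ Module.finrank ℝ E * 2 ^ (2 * Module.finrank ℝ W) := by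
      calc (1 : ℝ) < (32 / 25) ^ Module.finrank ℝ E :=
            one_lt_pow₀ (by norm_num) Module.finrank_pos.ne'
        _ = (16 / 25) ^ Module.finrank ℝ E * 2 ^ Module.finrank ℝ E := by
            rw [← mul_pow]; norm_num
        _ ≤ _ := by gcongr; norm_num
    rw [← h6] at h7
    exact (one_lt_sq_iff₀ (by positivity)).mp h7
  have h8 : |B.det| ≤ |A.det| := hA hBS
  rw [h3] at h8
  nlinarith

lemma exists_norm_sum_smul_le_sqrt {Y : Type*} [NormedAddCommGroup Y] [NormedSpace ℝ Y]
    (hY : ¬FiniteDimensional ℝ Y) (N : ℕ) :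
    ∃ y : Fin N → Y, (∀ i, 1 ≤ ‖y i‖) ∧ ∀ a : Fin N → ℝ,
      ‖∑ i, a i • y i‖ ≤ 4 * √(∑ i, a i ^ 2) := by
  rcases Nat.eq_zero_or_pos N with rfl | hN
  · exact ⟨fun _ => 0, fun i => i.elim0, fun a => by simp⟩
  have hE : Module.finrank ℝ (EuclideanSpace ℝ (Fin (2 * N))) = 2 * N := by simp
  have : Nontrivial (EuclideanSpace ℝ (Fin (2 * N))) :=
    Module.nontrivial_of_finrank_pos (R := ℝ) (by omega)
  obtain ⟨L, hL⟩ : ∃ L : EuclideanSpace ℝ (Fin (2 * N)) →ₗ[ℝ] Y, LinearMap.ker L = ⊥ := by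
    let b := Module.Basis.ofVectorSpace ℝ Y
    have : Infinite (Module.Basis.ofVectorSpaceIndex ℝ Y) := by
      by_contra h
      rw [not_infinite_iff_finite] at h
      exact hY (Module.Finite.of_basis b)
    let g : Fin (2 * N) → Module.Basis.ofVectorSpaceIndex ℝ Y := fun i => Infinite.natEmbedding _ i
    have hg : Function.Injective g := (Infinite.natEmbedding _).injective.comp Fin.val_injective
    have hli := b.linearIndependent.comp g hg
    refine ⟨Fintype.linearCombination ℝ (b ∘ g) ∘ₗ
      (WithLp.linearEquiv 2 ℝ (Fin (2 * N) → ℝ)).toLinearMap, ?_⟩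
    rw [LinearMap.ker_eq_bot]
    exact (linearIndependent_iff_injective_fintypeLinearCombination.1 hli).comp
      (LinearEquiv.injective _)
  obtain ⟨A, hA1, hA2⟩ := exists_half_norm_lt L hL
  have key (k : ℕ) (hk : k ≤ N) :
      ∃ f : Fin k → EuclideanSpace ℝ (Fin (2 * N)), Orthonormal ℝ f ∧
        ∀ i, 1 / 4 ≤ ‖L (A (f i))‖ := by
    induction k with
    | zero => exact ⟨fun _ => 0, ⟨fun i => i.elim0, fun i => i.elim0⟩, fun i => i.elim0⟩
    | succ k ih =>
      obtain ⟨f, hf, hfL⟩ := ih (by omega)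
      obtain ⟨x, hxW, hx⟩ := hA2 (Submodule.span ℝ (Set.range f))ᗮ (by
        have h1 := Submodule.finrank_add_finrank_orthogonal (Submodule.span ℝ (Set.range f))
        have h2 := finrank_range_le_card (R := ℝ) f
        rw [Set.finrank, Fintype.card_fin] at h2
        omega)
      have hx0 : x ≠ 0 := by
        rintro rfl
        simp at hx
      have hxn : 0 < ‖x‖ := norm_pos_iff.mpr hx0
      have hxf (i) : inner ℝ (f i) x = 0 :=
        Submodule.inner_right_of_mem_orthogonal (Submodule.subset_span (Set.mem_range_self i)) hxW
      refine ⟨Fin.cons (‖x‖⁻¹ • x) f, ⟨fun i => ?_, fun i j hij => ?_⟩, fun i => ?_⟩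
      · cases i using Fin.cases with
        | zero => simp [norm_smul, hxn.ne']
        | succ i => simpa using hf.1 i
      · cases i using Fin.cases with
        | zero =>
          cases j using Fin.cases with
          | zero => exact absurd rfl hij
          | succ j => simp [inner_smul_left, real_inner_comm (f j) x, hxf]
        | succ i =>
          cases j using Fin.cases with
          | zero => simp [inner_smul_right, hxf]
          | succ j => simpa using hf.2 (by simpa using hij)
      · cases i using Fin.cases with
        | zero =>
          simp only [Fin.cons_zero, map_smul, norm_smul, norm_inv, norm_norm]
          rw [le_inv_mul_iff₀ hxn]
          linarith
        | succ i => simpa using hfL i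
  obtain ⟨f, hf, hfL⟩ := key N le_rfl
  refine ⟨fun i => (4 : ℝ) • L (A (f i)), fun i => ?_, fun a => ?_⟩
  · rw [norm_smul, Real.norm_of_nonneg (by norm_num)]
    linarith [hfL i]
  · have h1 : ∑ i, a i • (4 : ℝ) • L (A (f i)) = (4 : ℝ) • L (A (∑ i, a i • f i)) := by
      simp only [map_sum, map_smul, Finset.smul_sum, smul_comm (4 : ℝ)]
    rw [h1, norm_smul, Real.norm_of_nonneg (by norm_num)]
    gcongr
    refine (hA1 _).trans (le_of_eq ?_)
    rw [norm_eq_sqrt_real_inner, hf.inner_sum]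
    simp [sq]

lemma hasFlatFamilies_of_lt_two {Y : Type*} [NormedAddCommGroup Y] [NormedSpace ℝ Y]
    (hY : ¬FiniteDimensional ℝ Y) {q l : ℝ} (hq : 0 < q) (hq2 : q < 2) (hql : q < l) :
    HasFlatFamilies ℝ Y q l := by
  have hl : 0 < l := hq.trans hql
  refine .of_upper_estimate hq (lt_min hq2 hql) (K := 4) fun N => ?_
  obtain ⟨y, hy, h⟩ := exists_norm_sum_smul_le_sqrt hY N
  refine ⟨N, le_rfl, y, hy, fun a ha => (h a).trans ?_⟩
  gcongr
  have h2 : ∑ i, a i ^ 2 = ∑ i, ‖a i‖ ^ (2 : ℝ) := by simp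
  rw [h2]
  rcases le_or_gt l 2 with hl2 | hl2
  · rw [min_eq_right hl2, sub_self, Real.rpow_zero]
    exact Real.sqrt_le_one.mpr (sum_rpow_le_one_of_le hl hl2 (fun i => norm_nonneg (a i)) ha)
  · rw [min_eq_left hl2.le]
    refine (Real.sqrt_le_sqrt (sum_rpow_le_card_rpow (by norm_num) hl2
      (fun i => norm_nonneg (a i)) ha)).trans (le_of_eq ?_)
    rw [Real.sqrt_eq_rpow, ← Real.rpow_mul (by positivity), Fintype.card_fin]
    congr 1
    ring

lemma Finset.sum_le_sum_range_of_forall_exists_le {α : Type*} {f : α → ℝ} {g : ℕ → ℝ}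
    (n : ℕ) : ∀ (B : Finset α) (_ : B.card = n)
      (_ : ∀ A ⊆ B, A.Nonempty → ∃ i ∈ A, f i ≤ g A.card),
      ∑ i ∈ B, f i ≤ ∑ j ∈ Finset.range n, g (j + 1) := by
  classical
  induction n with
  | zero =>
    intro B hB _
    rw [Finset.card_eq_zero.mp hB]
    simp
  | succ n ih =>
    intro B hB h
    obtain ⟨i, hi, hfi⟩ := h B subset_rfl (Finset.card_pos.mp (by omega))
    have h1 := ih (B.erase i) (by rw [Finset.card_erase_of_mem hi, hB]; rfl)
      fun A hA => h A (hA.trans (Finset.erase_subset _ _))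
    rw [← Finset.sum_erase_add _ _ hi, Finset.sum_range_succ]
    rw [hB] at hfi
    exact add_le_add h1 hfi

lemma exists_large_finset_avoiding {κ : Type*} [Fintype κ] [DecidableEq κ]
    (Bad : Finset κ → Prop)
    (h : ∀ 𝒜 : Finset (Finset κ), (𝒜 : Set (Finset κ)).PairwiseDisjoint id → (∀ A ∈ 𝒜, Bad A) →
      2 * ∑ A ∈ 𝒜, A.card ≤ Fintype.card κ) :
    ∃ R : Finset κ, Fintype.card κ ≤ 2 * R.card ∧ ∀ A ⊆ R, A.Nonempty → ¬Bad A := by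
  classical
  let V : Set (Finset (Finset κ)) :=
    {𝒜 | (𝒜 : Set (Finset κ)).PairwiseDisjoint id ∧ ∀ A ∈ 𝒜, Bad A}
  obtain ⟨𝒜, h𝒜⟩ := V.toFinite.exists_maximal ⟨∅, by simp [V]⟩
  refine ⟨(𝒜.biUnion id)ᶜ, ?_, fun A hA hne hbad => ?_⟩
  · have h1 := h 𝒜 h𝒜.prop.1 h𝒜.prop.2
    have h2 : (𝒜.biUnion id).card ≤ ∑ A ∈ 𝒜, A.card := Finset.card_biUnion_le
    rw [Finset.card_compl]
    have := Finset.card_le_univ (𝒜.biUnion id)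
    omega
  · have hdisj (B) (hB : B ∈ 𝒜) : Disjoint A B := by
      refine Finset.disjoint_left.mpr fun i hi hiB => ?_
      exact Finset.mem_compl.mp (hA hi) (Finset.mem_biUnion.mpr ⟨B, hB, hiB⟩)
    have hins : insert A 𝒜 ∈ V := by
      refine ⟨?_, by simpa using ⟨hbad, h𝒜.prop.2⟩⟩
      rw [Finset.coe_insert]
      exact h𝒜.prop.1.insert fun B hB _ => hdisj B hB
    have hmem : A ∈ 𝒜 := h𝒜.le_of_ge hins (Finset.subset_insert _ _) (Finset.mem_insert_self _ _)
    exact hne.ne_empty (disjoint_self.mp (hdisj A hmem))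

lemma signAvg_comp_injective {α κ : Type*} [Fintype α] [DecidableEq α] [Fintype κ] [DecidableEq κ]
    {u : α → κ} (hu : Function.Injective u) (G : (α → Bool) → ℝ) :
    signAvg (fun ε : κ → Bool => G (ε ∘ u)) = signAvg G := by
  let e : (κ → Bool) ≃ (α → Bool) × ({k // ¬ k ∈ Set.range u} → Bool) :=
    (Equiv.piEquivPiSubtypeProd (fun k => k ∈ Set.range u) fun _ => Bool).trans
      (Equiv.prodCongr ((Equiv.ofInjective u hu).symm.arrowCongr (Equiv.refl Bool)) (Equiv.refl _))
  have he (ε : κ → Bool) : (e ε).1 = ε ∘ u := by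
    funext a
    simp [e, Equiv.piEquivPiSubtypeProd, Equiv.arrowCongr]
  have hcard : Fintype.card κ = Fintype.card α + Fintype.card {k // ¬ k ∈ Set.range u} := by
    rw [← Fintype.card_congr (Equiv.sumCompl (· ∈ Set.range u)), Fintype.card_sum]
    exact congrArg (· + _) (Fintype.card_congr (Equiv.ofInjective u hu).symm)
  simp only [signAvg, ← he]
  rw [e.sum_comp (fun x => G x.1), Fintype.sum_prod_type]
  simp only [Finset.sum_const, Finset.card_univ, nsmul_eq_mul, ← Finset.mul_sum, hcard, pow_add]
  simp
  field_simp

lemma sg_beq {R : Type*} [Ring R] (a b : Bool) : sg R (a == b) = sg R a * sg R b := by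
  cases a <;> cases b <;> simp [sg]

/-- Multiplying all signs by a fixed choice of signs. -/
def mulSigns {κ : Type*} (τ : κ → Bool) : (κ → Bool) ≃ (κ → Bool) :=
  Function.Involutive.toPerm (fun ε i => ε i == τ i) fun ε => by
    have h : ∀ a b : Bool, ((a == b) == b) = a := by decide
    exact funext fun i => h _ _

lemma sg_mulSigns {R : Type*} [Ring R] {κ : Type*} (τ ε : κ → Bool) (i : κ) :
    sg R (mulSigns τ ε i) = sg R (ε i) * sg R (τ i) :=
  sg_beq _ _

lemma signAvg_norm_sq_contraction {Y : Type*} [NormedAddCommGroup Y] [NormedSpace ℝ Y]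
    {κ : Type*} [Fintype κ] [DecidableEq κ] (y : κ → Y) {θ : κ → ℝ}
    (hθ : ∀ i, θ i = 0 ∨ θ i = 1 ∨ θ i = -1) :
    signAvg (fun ε => ‖∑ i, (sg ℝ (ε i) * θ i) • y i‖ ^ 2) ≤
      signAvg fun ε => ‖∑ i, sg ℝ (ε i) • y i‖ ^ 2 := by
  have h1 (i) : ∃ τ : Bool × Bool, θ i = (sg ℝ τ.1 + sg ℝ τ.2) / 2 := by
    rcases hθ i with h | h | h
    · exact ⟨(true, false), by simp [sg, h]⟩
    · exact ⟨(true, true), by simp [sg, h]⟩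
    · exact ⟨(false, false), by norm_num [sg, h]⟩
  choose τ hτ using h1
  have h2 (σ : κ → Bool) : signAvg (fun ε => ‖∑ i, (sg ℝ (ε i) * sg ℝ (σ i)) • y i‖ ^ 2) =
      signAvg fun ε => ‖∑ i, sg ℝ (ε i) • y i‖ ^ 2 := by
    rw [← signAvg_comp_equiv (mulSigns σ)]
    simp only [sg_mulSigns, mul_assoc, sg_mul_self, mul_one]
  calc signAvg (fun ε => ‖∑ i, (sg ℝ (ε i) * θ i) • y i‖ ^ 2)
      ≤ signAvg (fun ε => (1 / 2) * ‖∑ i, (sg ℝ (ε i) * sg ℝ (τ i).1) • y i‖ ^ 2 +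
          (1 / 2) * ‖∑ i, (sg ℝ (ε i) * sg ℝ (τ i).2) • y i‖ ^ 2) := by
        refine signAvg_mono fun ε => ?_
        have h3 : ∑ i, (sg ℝ (ε i) * θ i) • y i =
            (1 / 2 : ℝ) • (∑ i, (sg ℝ (ε i) * sg ℝ (τ i).1) • y i +
              ∑ i, (sg ℝ (ε i) * sg ℝ (τ i).2) • y i) := by
          rw [← Finset.sum_add_distrib, Finset.smul_sum]
          refine Finset.sum_congr rfl fun i _ => ?_
          rw [← add_smul, smul_smul, hτ i]
          congr 1
          ring
        rw [h3, norm_smul, Real.norm_of_nonneg (by norm_num), mul_pow]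
        have h4 := norm_add_le (∑ i, (sg ℝ (ε i) * sg ℝ (τ i).1) • y i)
          (∑ i, (sg ℝ (ε i) * sg ℝ (τ i).2) • y i)
        have h5 := pow_le_pow_left₀ (norm_nonneg _) h4 2
        nlinarith [sq_nonneg (‖∑ i, (sg ℝ (ε i) * sg ℝ (τ i).1) • y i‖ -
          ‖∑ i, (sg ℝ (ε i) * sg ℝ (τ i).2) • y i‖)]
    _ = _ := by
        rw [signAvg_add, signAvg_const_mul, signAvg_const_mul, h2, h2 fun i => (τ i).2]
        ring

lemma signAvg_norm_sq_subset_le {Y : Type*} [NormedAddCommGroup Y] [NormedSpace ℝ Y]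
    {κ : Type*} [Fintype κ] [DecidableEq κ] (y : κ → Y) (A : Finset κ) :
    signAvg (fun ε => ‖∑ i ∈ A, sg ℝ (ε i) • y i‖ ^ 2) ≤
      signAvg fun ε => ‖∑ i, sg ℝ (ε i) • y i‖ ^ 2 := by
  refine le_of_eq_of_le ?_ (signAvg_norm_sq_contraction y (θ := fun i => if i ∈ A then 1 else 0)
    fun i => by by_cases h : i ∈ A <;> simp [h])
  simp [mul_ite, ite_smul]

lemma signAvg_minkowski {α κ : Type*} [Fintype α] [Fintype κ] [DecidableEq κ] {p : ℝ} (hp : 1 ≤ p)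
    (z : α → (κ → Bool) → ℝ) (hz : ∀ a ε, 0 ≤ z a ε) :
    (∑ a, signAvg (z a) ^ p) ^ (1 / p) ≤ signAvg fun ε => (∑ a, z a ε ^ p) ^ (1 / p) := by
  have : Fact (1 ≤ ENNReal.ofReal p) := ⟨by simpa using ENNReal.ofReal_le_ofReal hp⟩
  have hp0 : (ENNReal.ofReal p).toReal = p := ENNReal.toReal_ofReal (by linarith)
  have hnorm (v : α → ℝ) (hv : ∀ a, 0 ≤ v a) :
      ‖WithLp.toLp (ENNReal.ofReal p) v‖ = (∑ a, v a ^ p) ^ (1 / p) := by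
    rw [PiLp.norm_eq_sum (by rw [hp0]; linarith), hp0]
    simp [Real.norm_of_nonneg (hv _)]
  rw [← hnorm _ fun a => signAvg_nonneg (hz a)]
  simp only [← hnorm _ fun a => hz a _]
  have h1 : WithLp.toLp (ENNReal.ofReal p) (fun a => signAvg (z a)) =
      ((2 : ℝ) ^ Fintype.card κ)⁻¹ • ∑ ε, WithLp.toLp (ENNReal.ofReal p) fun a => z a ε := by
    ext a
    simp [signAvg]
  rw [h1, norm_smul, Real.norm_of_nonneg (by positivity), signAvg]
  gcongr
  exact norm_sum_le _ _

/-- `Y` has cotype `c` with constant `C`, for families indexed by arbitrary finite types. -/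
def HasCotypeConst (Y : Type*) [NormedAddCommGroup Y] [NormedSpace ℝ Y] (c C : ℝ) : Prop :=
  ∀ (κ : Type) [Fintype κ] [DecidableEq κ] (y : κ → Y),
    (∑ j, ‖y j‖ ^ c) ^ (1 / c) ≤ C * √(signAvg fun ε => ‖∑ j, sg ℝ (ε j) • y j‖ ^ 2)

lemma signAvg_comm {α κ : Type*} [Fintype α] [DecidableEq α] [Fintype κ] [DecidableEq κ]
    (F : (α → Bool) → (κ → Bool) → ℝ) :
    signAvg (fun δ => signAvg (F δ)) = signAvg fun ε => signAvg fun δ => F δ ε := by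
  simp only [signAvg, ← Finset.mul_sum]
  rw [Finset.sum_comm]
  ring

lemma exists_large_finset_avoiding_of_rpow {κ : Type*} [Fintype κ] [DecidableEq κ]
    (Bad : Finset κ → Prop) {c K D : ℝ} (hc : 0 < c) (hK : 0 < K)
    (hD : 2 * D ≤ K ^ c * Fintype.card κ)
    (h : ∀ 𝒜 : Finset (Finset κ), (𝒜 : Set (Finset κ)).PairwiseDisjoint id → (∀ A ∈ 𝒜, Bad A) →
      ∑ A ∈ 𝒜, (K * (A.card : ℝ) ^ (1 / c)) ^ c ≤ D) :
    ∃ R : Finset κ, Fintype.card κ ≤ 2 * R.card ∧ ∀ A ⊆ R, A.Nonempty → ¬Bad A := by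
  refine exists_large_finset_avoiding Bad fun 𝒜 hd hb => ?_
  have h1 := h 𝒜 hd hb
  have h2 (A : Finset κ) : (K * (A.card : ℝ) ^ (1 / c)) ^ c = K ^ c * A.card := by
    rw [Real.mul_rpow hK.le (by positivity), ← Real.rpow_mul (by positivity),
      one_div_mul_cancel hc.ne', Real.rpow_one]
  simp only [h2, ← Finset.mul_sum] at h1
  have h3 : K ^ c * (2 * ∑ A ∈ 𝒜, (A.card : ℝ)) ≤ K ^ c * Fintype.card κ := by linarith
  have h4 := le_of_mul_le_mul_left h3 (Real.rpow_pos_of_pos hK c)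
  exact_mod_cast h4

section HasCotypeConst

variable {Y : Type*} [NormedAddCommGroup Y] [NormedSpace ℝ Y] {c C : ℝ} {κ : Type} [Fintype κ]
  [DecidableEq κ]

lemma HasCotypeConst.sum_signAvg_rpow_le (h : HasCotypeConst Y c C) (hC : 0 ≤ C) (hc : 1 ≤ c)
    (y : κ → Y) {𝒜 : Finset (Finset κ)} (hd : (𝒜 : Set (Finset κ)).PairwiseDisjoint id) :
    ∑ A ∈ 𝒜, signAvg (fun ε : κ → Bool => ‖∑ i ∈ A, sg ℝ (ε i) • y i‖) ^ c ≤
      (C * √(signAvg fun ε => ‖∑ i, sg ℝ (ε i) • y i‖ ^ 2)) ^ c := by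
  have hc0 : 0 < c := by linarith
  set D := signAvg fun ε => ‖∑ i, sg ℝ (ε i) • y i‖ ^ 2
  rw [← Finset.sum_coe_sort]
  have h1 := signAvg_minkowski hc
    (fun (A : 𝒜) (ε : κ → Bool) => ‖∑ i ∈ A.1, sg ℝ (ε i) • y i‖) fun _ _ => norm_nonneg _
  have h2 (δ : 𝒜 → Bool) : signAvg (fun ε : κ → Bool =>
      ‖∑ A, sg ℝ (δ A) • ∑ i ∈ A.1, sg ℝ (ε i) • y i‖ ^ 2) ≤ D := by
    refine le_of_eq_of_le ?_ (signAvg_norm_sq_contraction y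
      (θ := fun i => ∑ A : 𝒜, if i ∈ A.1 then sg ℝ (δ A) else 0) fun i => ?_)
    · congr 1
      funext ε
      congr 2
      simp only [Finset.mul_sum, Finset.sum_smul, Finset.smul_sum, mul_ite, mul_zero, ite_smul,
        zero_smul]
      rw [Finset.sum_comm]
      refine Finset.sum_congr rfl fun A _ => ?_
      rw [← Finset.sum_filter]
      simp [smul_smul, mul_comm]
    · by_cases hi : ∃ A : 𝒜, i ∈ A.1
      · obtain ⟨A, hA⟩ := hi
        rw [Finset.sum_eq_single A]
        · right
          cases δ A <;> simp [sg, hA]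
        · intro B _ hBA
          rw [if_neg]
          intro hB
          exact Finset.disjoint_left.mp
            (hd B.2 A.2 fun h => hBA (Subtype.ext h)) hB hA
        · simp
      · left
        push Not at hi
        exact Finset.sum_eq_zero fun A _ => by simp [hi A]
  have h3 : signAvg (fun ε : κ → Bool =>
      (∑ A : 𝒜, ‖∑ i ∈ A.1, sg ℝ (ε i) • y i‖ ^ c) ^ (1 / c)) ≤ C * √D := by
    calc _ ≤ signAvg (fun ε : κ → Bool => C * √(signAvg fun δ : 𝒜 → Bool =>
          ‖∑ A, sg ℝ (δ A) • ∑ i ∈ A.1, sg ℝ (ε i) • y i‖ ^ 2)) :=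
          signAvg_mono fun ε => h 𝒜 _
      _ ≤ C * √D := by
        rw [signAvg_const_mul]
        gcongr
        refine (signAvg_le_sqrt fun ε => Real.sqrt_nonneg _).trans (Real.sqrt_le_sqrt ?_)
        have h4 (ε : κ → Bool) := Real.sq_sqrt (signAvg_nonneg
          (f := fun δ : 𝒜 → Bool => ‖∑ A, sg ℝ (δ A) • ∑ i ∈ A.1, sg ℝ (ε i) • y i‖ ^ 2)
          fun δ => by positivity)
        simp only [h4]
        rw [signAvg_comm]
        exact (signAvg_mono h2).trans (signAvg_const D).le
  have h5 := Real.rpow_le_rpow (Real.rpow_nonneg (Finset.sum_nonneg fun A _ =>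
    Real.rpow_nonneg (signAvg_nonneg fun _ => norm_nonneg _) _) _) (h1.trans h3) hc0.le
  rwa [← Real.rpow_mul (Finset.sum_nonneg fun A _ => Real.rpow_nonneg
    (signAvg_nonneg fun _ => norm_nonneg _) _), one_div_mul_cancel hc0.ne', Real.rpow_one] at h5

lemma HasCotypeConst.exists_subset_signAvg_le (h : HasCotypeConst Y c C) (hC : 0 ≤ C) (hc : 1 ≤ c)
    (y : κ → Y) {E K : ℝ} (hE : √(signAvg fun ε => ‖∑ i, sg ℝ (ε i) • y i‖ ^ 2) ≤ E)
    (hK : 0 < K) (hEK : 2 * (C * E) ^ c ≤ K ^ c * Fintype.card κ) :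
    ∃ R : Finset κ, Fintype.card κ ≤ 2 * R.card ∧ ∀ A ⊆ R, A.Nonempty →
      signAvg (fun ε : κ → Bool => ‖∑ i ∈ A, sg ℝ (ε i) • y i‖) ≤
        K * (A.card : ℝ) ^ (1 / c) := by
  have hc0 : 0 < c := by linarith
  obtain ⟨R, hR, hR'⟩ := exists_large_finset_avoiding_of_rpow
    (fun A : Finset κ => K * (A.card : ℝ) ^ (1 / c) <
      signAvg (fun ε : κ → Bool => ‖∑ i ∈ A, sg ℝ (ε i) • y i‖)) hc0 hK hEK (by
    intro 𝒜 hd hb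
    calc _ ≤ ∑ A ∈ 𝒜, signAvg (fun ε : κ → Bool => ‖∑ i ∈ A, sg ℝ (ε i) • y i‖) ^ c := by
          refine Finset.sum_le_sum fun A hA => ?_
          have := (hb A hA).le
          gcongr
      _ ≤ _ := h.sum_signAvg_rpow_le hC hc y hd
      _ ≤ (C * E) ^ c := by gcongr)
  exact ⟨R, hR, fun A hA hne => not_lt.mp (hR' A hA hne)⟩

lemma HasCotypeConst.exists_subset_sum_abs_le (h : HasCotypeConst Y c C) (hC : 0 ≤ C) (hc : 1 ≤ c)
    (y : κ → Y) {M K : ℝ} (hM : ∀ f : Y →L[ℝ] ℝ, ‖f‖ ≤ 1 → ∑ i, |f (y i)| ≤ M)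
    (hK : 0 < K) (hMK : 2 * (C * M) ^ c ≤ K ^ c * Fintype.card κ) :
    ∃ R : Finset κ, Fintype.card κ ≤ 2 * R.card ∧ ∀ A ⊆ R, A.Nonempty →
      ∀ f : Y →L[ℝ] ℝ, ‖f‖ ≤ 1 → ∑ i ∈ A, |f (y i)| ≤ K * (A.card : ℝ) ^ (1 / c) := by
  have hc0 : 0 < c := by linarith
  have hM0 : 0 ≤ M := by simpa using hM 0 (by simp)
  obtain ⟨R, hR, hR'⟩ := exists_large_finset_avoiding_of_rpow
    (fun A : Finset κ => ∃ f : Y →L[ℝ] ℝ, ‖f‖ ≤ 1 ∧ K * (A.card : ℝ) ^ (1 / c) <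
      ∑ i ∈ A, |f (y i)|) hc0 hK hMK (by
    intro 𝒜 hd hb
    have hb' (A : 𝒜) := hb A.1 A.2
    choose f hf hfA using hb'
    let z (A : 𝒜) : Y := ∑ i ∈ A.1, (SignType.sign (f A (y i)) : ℝ) • y i
    have hz (A : 𝒜) : K * (A.1.card : ℝ) ^ (1 / c) ≤ ‖z A‖ := by
      refine (hfA A).le.trans ?_
      have h1 : ∑ i ∈ A.1, |f A (y i)| = f A (z A) := by
        simp only [z, map_sum, map_smul, smul_eq_mul, sign_mul_self]
      rw [h1]
      exact (le_abs_self _).trans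
        ((f A).le_of_opNorm_le_of_le (hf A) le_rfl |>.trans (one_mul _).le)
    have hzM (δ : 𝒜 → Bool) : ‖∑ A, sg ℝ (δ A) • z A‖ ≤ M := by
      obtain ⟨g, hg, hgz⟩ := exists_dual_vector'' ℝ (∑ A, sg ℝ (δ A) • z A)
      refine le_trans ?_ (hM g hg)
      have h1 : ‖∑ A, sg ℝ (δ A) • z A‖ = ∑ A : 𝒜, ∑ i ∈ A.1,
          sg ℝ (δ A) * ((SignType.sign (f A (y i)) : ℝ) * g (y i)) := by
        have h2 : g (∑ A, sg ℝ (δ A) • z A) = ‖∑ A, sg ℝ (δ A) • z A‖ := hgz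
        rw [← h2]
        simp only [z, map_sum, map_smul, smul_eq_mul, Finset.mul_sum]
      rw [h1]
      calc _ ≤ ∑ A : 𝒜, ∑ i ∈ A.1, |g (y i)| := by
            refine Finset.sum_le_sum fun A _ => Finset.sum_le_sum fun i _ => ?_
            refine (le_abs_self _).trans ?_
            rw [abs_mul, abs_mul, ← Real.norm_eq_abs, norm_sg, one_mul]
            refine mul_le_of_le_one_left (abs_nonneg _) ?_
            rcases SignType.sign (f A (y i)) with _ | _ | _ <;> simp
        _ = ∑ i ∈ 𝒜.biUnion id, |g (y i)| :=
            (Finset.sum_coe_sort 𝒜 fun A => ∑ i ∈ A, |g (y i)|).trans (Finset.sum_biUnion hd).symm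
        _ ≤ ∑ i, |g (y i)| :=
            Finset.sum_le_sum_of_subset_of_nonneg (Finset.subset_univ _) fun _ _ _ => abs_nonneg _
    have h1 : (∑ A, ‖z A‖ ^ c) ^ (1 / c) ≤ C * M := by
      refine (h 𝒜 z).trans ?_
      gcongr
      rw [Real.sqrt_le_left hM0]
      refine (signAvg_mono (g := fun _ => M ^ 2) fun δ => ?_).trans (signAvg_const _).le
      exact pow_le_pow_left₀ (norm_nonneg _) (hzM δ) 2
    have h2 := Real.rpow_le_rpow (by positivity) h1 hc0.le
    rw [← Real.rpow_mul (by positivity), one_div_mul_cancel hc0.ne', Real.rpow_one] at h2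
    refine le_trans ?_ h2
    rw [← Finset.sum_coe_sort]
    gcongr with A
    exact hz A)
  refine ⟨R, hR, fun A hA hne f hf => ?_⟩
  by_contra! hlt
  exact hR' A hA hne ⟨f, hf, hlt⟩

end HasCotypeConst

lemma ciSup_add_abs_add_ciSup_sub_abs_le {τ : Type*} [Nonempty τ] (h v : τ → ℝ)
    (h1 : BddAbove (Set.range fun a => h a + v a)) (h2 : BddAbove (Set.range fun a => h a - v a)) :
    (⨆ a, (h a + |v a|)) + ⨆ a, (h a - |v a|) ≤ (⨆ a, (h a + v a)) + ⨆ a, (h a - v a) := by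
  rw [← le_sub_iff_add_le]
  refine ciSup_le fun a => ?_
  rw [le_sub_iff_add_le, ← le_sub_iff_add_le']
  refine ciSup_le fun b => ?_
  have ha := le_ciSup h1 a
  have hb := le_ciSup h1 b
  have ha' := le_ciSup h2 a
  have hb' := le_ciSup h2 b
  rcases abs_cases (v a) with h3 | h3 <;> rcases abs_cases (v b) with h4 | h4 <;> linarith

lemma signAvg_iSup_abs_le {τ κ : Type*} [Nonempty τ] [Fintype κ] [DecidableEq κ] (t : τ → κ → ℝ)
    {M : ℝ} (hM : ∀ a i, |t a i| ≤ M) :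
    signAvg (fun ε : κ → Bool => ⨆ a, ∑ i, sg ℝ (ε i) * |t a i|) ≤
      signAvg fun ε : κ → Bool => ⨆ a, ∑ i, sg ℝ (ε i) * t a i := by
  let T (s : Finset κ) (a : τ) (i : κ) : ℝ := if i ∈ s then |t a i| else t a i
  let G (s : Finset κ) (ε : κ → Bool) : ℝ := ⨆ a, ∑ i, sg ℝ (ε i) * T s a i
  have hT (s a i) : |T s a i| ≤ M := by
    simp only [T]
    split_ifs
    · rw [abs_abs]; exact hM a i
    · exact hM a i
  have hbdd (s) (ε : κ → Bool) (F : Finset κ) :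
      ∀ a, |∑ i ∈ F, sg ℝ (ε i) * T s a i| ≤ F.card * M := fun a => by
    refine (Finset.abs_sum_le_sum_abs _ _).trans ((Finset.sum_le_card_nsmul _ _ M
      fun i _ => ?_).trans (by simp))
    rw [abs_mul, ← Real.norm_eq_abs, norm_sg, one_mul]
    exact hT s a i
  have key (s : Finset κ) : signAvg (G s) ≤ signAvg (G ∅) := by
    induction s using Finset.induction_on with
    | empty => rfl
    | insert j s hj ih =>
      refine le_trans ?_ ih
      have h1 (ε : κ → Bool) : G (insert j s) ε + G (insert j s) (flipAt j ε) ≤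
          G s ε + G s (flipAt j ε) := by
        let h (a : τ) : ℝ := ∑ i ∈ Finset.univ.erase j, sg ℝ (ε i) * T s a i
        have e1 (a : τ) : ∑ i, sg ℝ (ε i) * T s a i = h a + sg ℝ (ε j) * t a j := by
          rw [← Finset.sum_erase_add _ _ (Finset.mem_univ j)]
          simp [T, hj, h]
        have e2 (a : τ) : ∑ i, sg ℝ (flipAt j ε i) * T s a i = h a - sg ℝ (ε j) * t a j := by
          rw [← Finset.sum_erase_add _ _ (Finset.mem_univ j), flipAt_self, sg_not, sub_eq_add_neg]
          congr 1
          · refine Finset.sum_congr rfl fun i hi => ?_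
            rw [flipAt_of_ne (Finset.ne_of_mem_erase hi)]
          · simp [T, hj]
        have e3 (a : τ) : ∑ i, sg ℝ (ε i) * T (insert j s) a i = h a + sg ℝ (ε j) * |t a j| := by
          rw [← Finset.sum_erase_add _ _ (Finset.mem_univ j)]
          congr 1
          · refine Finset.sum_congr rfl fun i hi => ?_
            simp [T, Finset.ne_of_mem_erase hi]
          · simp [T]
        have e4 (a : τ) : ∑ i, sg ℝ (flipAt j ε i) * T (insert j s) a i =
            h a - sg ℝ (ε j) * |t a j| := by
          rw [← Finset.sum_erase_add _ _ (Finset.mem_univ j), flipAt_self, sg_not, sub_eq_add_neg]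
          congr 1
          · refine Finset.sum_congr rfl fun i hi => ?_
            rw [flipAt_of_ne (Finset.ne_of_mem_erase hi)]
            simp [T, Finset.ne_of_mem_erase hi]
          · simp [T]
        have b1 : BddAbove (Set.range fun a => h a + t a j) := by
          refine ⟨(Finset.univ.erase j).card * M + M, ?_⟩
          rintro _ ⟨a, rfl⟩
          exact add_le_add ((le_abs_self _).trans (hbdd s ε _ a)) ((le_abs_self _).trans (hM a j))
        have b2 : BddAbove (Set.range fun a => h a - t a j) := by
          refine ⟨(Finset.univ.erase j).card * M + M, ?_⟩
          rintro _ ⟨a, rfl⟩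
          exact add_le_add ((le_abs_self _).trans (hbdd s ε _ a))
            ((neg_le_abs _).trans (hM a j))
        have h2 := ciSup_add_abs_add_ciSup_sub_abs_le h (fun a => t a j) b1 b2
        simp only [G, e1, e2, e3, e4]
        cases ε j
        · simp only [sg, Bool.false_eq_true, if_false, neg_mul, one_mul, sub_neg_eq_add,
            ← sub_eq_add_neg]
          linarith
        · simpa [sg] using h2
      have h3 := signAvg_mono h1
      rw [signAvg_add, signAvg_add, signAvg_comp_equiv, signAvg_comp_equiv] at h3
      linarith
  simpa [G, T] using key Finset.univ

section

variable {Y : Type*} [NormedAddCommGroup Y] [NormedSpace ℝ Y]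

lemma signAvg_iSup_abs_dual_le {α : Type*} [Fintype α] [DecidableEq α] (w : α → Y) :
    signAvg (fun δ : α → Bool => ⨆ f : {f : Y →L[ℝ] ℝ // ‖f‖ ≤ 1}, ∑ p, sg ℝ (δ p) * |f.1 (w p)|) ≤
      signAvg fun δ : α → Bool => ‖∑ p, sg ℝ (δ p) • w p‖ := by
  have : Nonempty {f : Y →L[ℝ] ℝ // ‖f‖ ≤ 1} := ⟨0, by simp⟩
  have hle (f : {f : Y →L[ℝ] ℝ // ‖f‖ ≤ 1}) (x : Y) : |f.1 x| ≤ ‖x‖ := by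
    simpa using f.1.le_of_opNorm_le f.2 x
  refine (signAvg_iSup_abs_le (M := ∑ p, ‖w p‖) _ fun f p => (hle f _).trans
    (Finset.single_le_sum (f := fun p => ‖w p‖) (fun _ _ => norm_nonneg _)
      (Finset.mem_univ p))).trans ?_
  refine signAvg_mono fun δ => ciSup_le fun f => ?_
  have h1 : ∑ p, sg ℝ (δ p) * f.1 (w p) = f.1 (∑ p, sg ℝ (δ p) • w p) := by simp
  rw [h1]
  exact (le_abs_self _).trans (hle f _)

lemma exists_half_selection {α : Type*} [Fintype α] [DecidableEq α] (y : α × Bool → Y) {S B : ℝ}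
    (hS : ∀ f : Y →L[ℝ] ℝ, ‖f‖ ≤ 1 → ∑ x, |f (y x)| ≤ S)
    (hB : ∀ b, signAvg (fun δ : α → Bool => ‖∑ p, sg ℝ (δ p) • y (p, b)‖) ≤ B) :
    ∃ δ : α → Bool, ∀ f : Y →L[ℝ] ℝ, ‖f‖ ≤ 1 → ∑ p, |f (y (p, δ p))| ≤ S / 2 + B := by
  let Φ (b : Bool) (δ : α → Bool) : ℝ :=
    ⨆ f : {f : Y →L[ℝ] ℝ // ‖f‖ ≤ 1}, ∑ p, sg ℝ (δ p) * |f.1 (y (p, b))|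
  have hΦ (b) : signAvg (Φ b) ≤ B := (signAvg_iSup_abs_dual_le fun p => y (p, b)).trans (hB b)
  have hbdd (b) (δ : α → Bool) : BddAbove (Set.range fun f : {f : Y →L[ℝ] ℝ // ‖f‖ ≤ 1} =>
      ∑ p, sg ℝ (δ p) * |f.1 (y (p, b))|) := by
    refine ⟨∑ p, ‖y (p, b)‖, ?_⟩
    rintro _ ⟨f, rfl⟩
    refine Finset.sum_le_sum fun p _ => (le_abs_self _).trans ?_
    rw [abs_mul, ← Real.norm_eq_abs, norm_sg, one_mul, abs_abs]
    simpa using f.1.le_of_opNorm_le f.2 (y (p, b))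
  obtain ⟨δ, hδ⟩ := exists_le_signAvg fun δ : α → Bool => Φ true δ + Φ false fun p => !δ p
  have hnot : signAvg (fun δ : α → Bool => Φ false fun p => !δ p) = signAvg (Φ false) :=
    signAvg_comp_equiv (f := Φ false) (Equiv.arrowCongr (Equiv.refl α) Equiv.boolNot)
  rw [signAvg_add, hnot] at hδ
  refine ⟨δ, fun f hf => ?_⟩
  have h1 := le_ciSup (hbdd true δ) ⟨f, hf⟩
  have h2 := le_ciSup (hbdd false fun p => !δ p) ⟨f, hf⟩
  have h3 := hS f hf
  rw [Fintype.sum_prod_type] at h3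
  simp only [Fintype.sum_bool, Finset.sum_add_distrib] at h3
  have h4 : ∑ p, |f (y (p, δ p))| = 1 / 2 * (∑ p, |f (y (p, true))| + ∑ p, |f (y (p, false))|) +
      1 / 2 * (∑ p, sg ℝ (δ p) * |f (y (p, true))| + ∑ p, sg ℝ (!δ p) * |f (y (p, false))|) := by
    simp only [← Finset.sum_add_distrib, Finset.mul_sum]
    refine Finset.sum_congr rfl fun p _ => ?_
    cases δ p <;> simp [sg] <;> ring
  have h5 := hΦ true
  have h6 := hΦ false
  simp only [Φ] at hδ h5 h6
  simp only at h1 h2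
  rw [h4]
  linarith

end

section NotHasCotype

variable {Y : Type*} [NormedAddCommGroup Y] [NormedSpace ℝ Y]

lemma norm_le_sqrt_signAvg {κ : Type*} [Fintype κ] [DecidableEq κ] (y : κ → Y) (i : κ) :
    ‖y i‖ ≤ √(signAvg fun ε => ‖∑ j, sg ℝ (ε j) • y j‖ ^ 2) := by
  refine Real.le_sqrt_of_sq_le ?_
  have h1 := signAvg_norm_sq_subset_le y {i}
  simpa [norm_smul, norm_sg, signAvg_const] using h1

lemma exists_signAvg_lt_of_not_hasCotype {s t κ₀ : ℝ} (ht : 0 < t) (hts : t < s)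
    (hs : ¬HasCotype Y s) (hκ₀ : 0 < κ₀) :
    ∃ (κ : Type) (_ : Fintype κ) (_ : DecidableEq κ) (y : κ → Y), Nonempty κ ∧
      (∀ i, 1 ≤ ‖y i‖) ∧
      √(signAvg fun ε => ‖∑ j, sg ℝ (ε j) • y j‖ ^ 2) < κ₀ * (Fintype.card κ : ℝ) ^ (1 / t) := by
  by_contra! hno
  have hs0 : 0 < s := ht.trans hts
  have hsum : Summable fun j : ℕ => ((j + 1 : ℕ) : ℝ) ^ (-(s / t)) := by
    rw [summable_nat_add_iff 1 (f := fun j : ℕ => (j : ℝ) ^ (-(s / t)))]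
    exact Real.summable_nat_rpow.mpr (neg_lt_neg ((one_lt_div ht).mpr hts))
  set Z := ∑' j : ℕ, ((j + 1 : ℕ) : ℝ) ^ (-(s / t)) with hZ
  have hZ0 : 0 ≤ Z := tsum_nonneg fun j => by positivity
  refine hs ⟨Z ^ (1 / s) / κ₀, by positivity, fun k x => ?_⟩
  set E := √(signAvg fun ε => ‖∑ j, sg ℝ (ε j) • x j‖ ^ 2) with hE
  have hE' : √((2 ^ k : ℝ)⁻¹ * ∑ ε : Fin k → Bool, ‖∑ j, (if ε j then x j else -x j)‖ ^ 2) = E := by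
    simp [hE, signAvg, sg_smul]
  have hE0 : 0 ≤ E := Real.sqrt_nonneg _
  rw [hE']
  have key : ∑ j, ‖x j‖ ^ s ≤
      ∑ j ∈ Finset.range k, (E / κ₀) ^ s * ((j + 1 : ℕ) : ℝ) ^ (-(s / t)) := by
    refine Finset.sum_le_sum_range_of_forall_exists_le (f := fun j => ‖x j‖ ^ s)
      (g := fun j => (E / κ₀) ^ s * (j : ℝ) ^ (-(s / t))) k Finset.univ (by simp)
      fun A _ hA => ?_
    obtain ⟨i, hi, hmin⟩ := A.exists_min_image (fun i => ‖x i‖) hA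
    refine ⟨i, hi, ?_⟩
    rcases (norm_nonneg (x i)).eq_or_lt with h0 | h0
    · rw [← h0, Real.zero_rpow hs0.ne']
      positivity
    have hApos : (0 : ℝ) < A.card := by exact_mod_cast hA.card_pos
    have h1 := hno A inferInstance inferInstance (fun a => ‖x i‖⁻¹ • x a) ⟨⟨i, hi⟩⟩ fun a => by
      rw [norm_smul, norm_inv, norm_norm, ← div_eq_inv_mul, one_le_div h0]
      exact hmin a a.2
    have h2 : √(signAvg fun ε : A → Bool => ‖∑ a, sg ℝ (ε a) • ‖x i‖⁻¹ • x a‖ ^ 2) ≤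
        ‖x i‖⁻¹ * E := by
      refine Real.sqrt_le_iff.mpr ⟨by positivity, ?_⟩
      rw [mul_pow, hE, Real.sq_sqrt (signAvg_nonneg fun _ => sq_nonneg _)]
      refine le_of_eq_of_le ?_ (mul_le_mul_of_nonneg_left (signAvg_norm_sq_subset_le x A)
        (sq_nonneg _))
      rw [← signAvg_const_mul, ← signAvg_comp_injective (u := ((↑) : A → Fin k))
        Subtype.val_injective]
      congr 1
      funext ε
      rw [← Finset.sum_coe_sort A]
      simp only [smul_comm _ ‖x i‖⁻¹, ← Finset.smul_sum, norm_smul, mul_pow, norm_inv, norm_norm,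
        Function.comp]
    have h3 : ‖x i‖ ≤ E / κ₀ * (A.card : ℝ) ^ (-(1 / t)) := by
      have h4 := h1.trans h2
      rw [Fintype.card_coe] at h4
      rw [Real.rpow_neg hApos.le, ← div_eq_mul_inv, div_div, le_div_iff₀ (by positivity)]
      rwa [← div_eq_inv_mul, le_div_iff₀ h0, mul_comm] at h4
    calc ‖x i‖ ^ s ≤ (E / κ₀ * (A.card : ℝ) ^ (-(1 / t))) ^ s := by gcongr
      _ = _ := by
        rw [Real.mul_rpow (by positivity) (by positivity), ← Real.rpow_mul hApos.le]
        congr 2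
        ring
  have key2 : ∑ j, ‖x j‖ ^ s ≤ (E / κ₀) ^ s * Z := by
    refine key.trans ?_
    rw [← Finset.mul_sum]
    gcongr
    exact hsum.sum_le_tsum _ fun j _ => by positivity
  calc (∑ j, ‖x j‖ ^ s) ^ (1 / s) ≤ ((E / κ₀) ^ s * Z) ^ (1 / s) := by gcongr
    _ = Z ^ (1 / s) / κ₀ * E := by
      rw [Real.mul_rpow (by positivity) hZ0, ← Real.rpow_mul (by positivity),
        mul_one_div_cancel hs0.ne', Real.rpow_one]
      ring

lemma exists_large_signAvg_le_of_not_hasCotype {s t : ℝ} (ht : 0 < t) (hts : t < s)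
    (hs : ¬HasCotype Y s) (N : ℕ) :
    ∃ (κ : Type) (_ : Fintype κ) (_ : DecidableEq κ) (y : κ → Y), N ≤ Fintype.card κ ∧
      (∀ i, 1 ≤ ‖y i‖) ∧
      √(signAvg fun ε => ‖∑ j, sg ℝ (ε j) • y j‖ ^ 2) ≤ (Fintype.card κ : ℝ) ^ (1 / t) := by
  obtain ⟨κ, _, _, y, ⟨i⟩, hy, hlt⟩ := exists_signAvg_lt_of_not_hasCotype ht hts hs
    (κ₀ := ((N + 1 : ℝ) ^ (1 / t))⁻¹) (by positivity)
  have h1 : (1 : ℝ) ≤ (N + 1 : ℝ) ^ (1 / t) :=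
    Real.one_le_rpow (by linarith [N.cast_nonneg (α := ℝ)]) (by positivity)
  rw [← div_eq_inv_mul] at hlt
  refine ⟨κ, ‹_›, ‹_›, y, ?_, hy, hlt.le.trans (div_le_self (by positivity) h1)⟩
  have h2 := (hy i).trans_lt ((norm_le_sqrt_signAvg y i).trans_lt hlt)
  rw [one_lt_div (by positivity)] at h2
  have h3 := (Real.rpow_lt_rpow_iff (by positivity) (by positivity) (by positivity)).mp h2
  have h4 : N + 1 < Fintype.card κ := by exact_mod_cast h3
  omega

end NotHasCotype

section Halving

variable {Y : Type*} [NormedAddCommGroup Y] [NormedSpace ℝ Y] {κ : Type*} [Fintype κ]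
  [DecidableEq κ] {c K : ℝ} {y : κ → Y} {R : Finset κ}

lemma exists_injective_half
    (hR : ∀ A ⊆ R, A.Nonempty →
      signAvg (fun ε : κ → Bool => ‖∑ i ∈ A, sg ℝ (ε i) • y i‖) ≤ K * (A.card : ℝ) ^ (1 / c))
    {b : ℕ} {S : ℝ} {g : Fin (2 ^ (b + 1)) → κ} (hg : Function.Injective g) (hgR : ∀ i, g i ∈ R)
    (hS : ∀ f : Y →L[ℝ] ℝ, ‖f‖ ≤ 1 → ∑ i, |f (y (g i))| ≤ S) :
    ∃ h : Fin (2 ^ b) → κ, Function.Injective h ∧ (∀ i, h i ∈ R) ∧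
      ∀ f : Y →L[ℝ] ℝ, ‖f‖ ≤ 1 → ∑ i, |f (y (h i))| ≤ S / 2 + K * ((2 : ℝ) ^ b) ^ (1 / c) := by
  have e : Fin (2 ^ b) × Bool ≃ Fin (2 ^ (b + 1)) :=
    Fintype.equivOfCardEq (by simp [pow_succ])
  obtain ⟨δ, hδ⟩ := exists_half_selection (fun x => y (g (e x))) (S := S)
    (B := K * ((2 : ℝ) ^ b) ^ (1 / c))
    (fun f hf => by simpa only [e.sum_comp fun i => |f (y (g i))|] using hS f hf) fun β => by
      have hu : Function.Injective fun p => g (e (p, β)) := fun p p' h => by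
        simpa using e.injective (hg h)
      have hcard : (Finset.univ.image fun p => g (e (p, β))).card = 2 ^ b := by
        rw [Finset.card_image_of_injective _ hu]
        simp
      have h1 := hR (Finset.univ.image fun p => g (e (p, β)))
        (fun i hi => by
          obtain ⟨p, -, rfl⟩ := Finset.mem_image.mp hi
          exact hgR _)
        (Finset.univ_nonempty.image _)
      rw [hcard] at h1
      rw [← signAvg_comp_injective hu]
      simp only [Finset.sum_image hu.injOn] at h1
      exact_mod_cast h1
  refine ⟨fun p => g (e (p, δ p)), fun p p' h => ?_, fun p => hgR _, hδ⟩
  exact congrArg Prod.fst (e.injective (hg h))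

lemma exists_injective_sum_abs_le (hc : 2 ≤ c) (hK : 0 ≤ K)
    (hR : ∀ A ⊆ R, A.Nonempty →
      signAvg (fun ε : κ → Bool => ‖∑ i ∈ A, sg ℝ (ε i) • y i‖) ≤ K * (A.card : ℝ) ^ (1 / c))
    {S : ℝ} (hS : ∀ f : Y →L[ℝ] ℝ, ‖f‖ ≤ 1 → ∑ i, |f (y i)| ≤ S) (j : ℕ) :
    ∀ b : ℕ, 2 ^ (b + j) ≤ R.card → ∃ g : Fin (2 ^ b) → κ, Function.Injective g ∧
      (∀ i, g i ∈ R) ∧ ∀ f : Y →L[ℝ] ℝ, ‖f‖ ≤ 1 →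
        ∑ i, |f (y (g i))| ≤ S / 2 ^ j + 4 * K * ((2 : ℝ) ^ b) ^ (1 / c) := by
  induction j with
  | zero =>
    intro b hb
    obtain ⟨A, hAR, hA⟩ := Finset.exists_subset_card_eq hb
    let g : Fin (2 ^ b) → κ := fun i => ((Finset.equivFinOfCardEq hA).symm i : κ)
    have hg : Function.Injective g := Subtype.val_injective.comp (Equiv.injective _)
    refine ⟨g, hg, fun i => hAR (Subtype.mem _), fun f hf => ?_⟩
    calc ∑ i, |f (y (g i))| = ∑ k ∈ Finset.univ.image g, |f (y k)| :=
          (Finset.sum_image (f := fun k => |f (y k)|) hg.injOn).symm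
      _ ≤ ∑ k, |f (y k)| :=
          Finset.sum_le_sum_of_subset_of_nonneg (Finset.subset_univ _) fun _ _ _ => abs_nonneg _
      _ ≤ S := hS f hf
      _ ≤ _ := by
        have : 0 ≤ 4 * K * ((2 : ℝ) ^ b) ^ (1 / c) := by positivity
        simpa using this
  | succ j ih =>
    intro b hb
    obtain ⟨g, hg, hgR, hgS⟩ := ih (b + 1) (by rwa [add_right_comm, add_assoc])
    obtain ⟨h, hh, hhR, hhS⟩ := exists_injective_half hR hg hgR hgS
    refine ⟨h, hh, hhR, fun f hf => (hhS f hf).trans ?_⟩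
    have h1 : (2 : ℝ) ^ (1 / c) ≤ 3 / 2 := by
      calc (2 : ℝ) ^ (1 / c) ≤ 2 ^ (1 / 2 : ℝ) :=
            Real.rpow_le_rpow_of_exponent_le one_le_two (one_div_le_one_div_of_le two_pos hc)
        _ ≤ 3 / 2 := by
            rw [← Real.sqrt_eq_rpow]
            exact Real.sqrt_le_iff.mpr (by norm_num)
    have h2 : ((2 : ℝ) ^ (b + 1)) ^ (1 / c) ≤ ((2 : ℝ) ^ b) ^ (1 / c) * (3 / 2) := by
      rw [pow_succ, Real.mul_rpow (by positivity) (by positivity)]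
      gcongr
    have h3 : K * ((2 : ℝ) ^ (b + 1)) ^ (1 / c) ≤ K * (((2 : ℝ) ^ b) ^ (1 / c) * (3 / 2)) := by
      gcongr
    rw [pow_succ 2 j, ← div_div]
    linarith

lemma sum_abs_le_sqrt_card_mul (y : κ → Y) (f : Y →L[ℝ] ℝ) (hf : ‖f‖ ≤ 1) :
    ∑ i, |f (y i)| ≤
      √(Fintype.card κ) * √(signAvg fun ε => ‖∑ i, sg ℝ (ε i) • y i‖ ^ 2) := by
  rw [← Real.sqrt_mul (Nat.cast_nonneg _)]
  refine Real.le_sqrt_of_sq_le ((sq_sum_le_card_mul_sum_sq ..).trans ?_)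
  rw [Finset.card_univ]
  gcongr
  have h1 := signAvg_norm_sq fun i => f (y i)
  simp only [sq_abs]
  simp only [Real.norm_eq_abs, sq_abs] at h1
  rw [← h1]
  refine signAvg_mono fun ε => ?_
  have h2 : ∑ i, sg ℝ (ε i) • f (y i) = f (∑ i, sg ℝ (ε i) • y i) := by simp
  rw [h2, ← sq_abs]
  gcongr
  simpa using f.le_of_opNorm_le hf (∑ i, sg ℝ (ε i) • y i)

end Halving

section CotypeSpread

variable {Y : Type*} [NormedAddCommGroup Y] [NormedSpace ℝ Y] {c C s t : ℝ}

lemma two_mul_rpow_le_rpow_mul {a k M c : ℝ} (hc : 1 ≤ c) (ha : 0 ≤ a) (hk : 0 ≤ k) (hM : 0 ≤ M)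
    (h : 2 * a ≤ k * M ^ (1 / c)) : 2 * a ^ c ≤ k ^ c * M := by
  have hc0 : 0 < c := by linarith
  calc 2 * a ^ c ≤ 2 ^ c * a ^ c := by
        gcongr
        simpa using Real.rpow_le_rpow_of_exponent_le one_le_two hc
    _ = (2 * a) ^ c := (Real.mul_rpow zero_le_two ha).symm
    _ ≤ (k * M ^ (1 / c)) ^ c := by gcongr
    _ = k ^ c * M := by
      rw [Real.mul_rpow hk (by positivity), ← Real.rpow_mul hM, one_div_mul_cancel hc0.ne',
        Real.rpow_one]

lemma HasCotypeConst.exists_sum_abs_le (h : HasCotypeConst Y c C) (hC : 1 ≤ C) (ht : 2 < t)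
    (hts : t < s) (hsc : s ≤ c) (hs : ¬HasCotype Y s) {ζ : ℝ} (hζ : ζ ≤ 1)
    (hζt : ζ * (1 / 2 - 1 / t) = 1 / t - 1 / c) (M : ℕ) :
    ∃ b : ℕ, M ≤ b ∧ ∃ w : Fin (2 ^ b) → Y, (∀ i, 1 ≤ ‖w i‖) ∧ ∀ f : Y →L[ℝ] ℝ, ‖f‖ ≤ 1 →
      ∑ i, |f (w i)| ≤ 24 * C * ((2 : ℝ) ^ b) ^ (1 / c + ζ) := by
  have hθ : 0 < 1 / 2 - 1 / t := sub_pos.mpr (one_div_lt_one_div_of_lt two_pos ht)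
  have hη : 0 < 1 / t - 1 / c :=
    sub_pos.mpr (one_div_lt_one_div_of_lt (by linarith) (hts.trans_le hsc))
  have hζ0 : 0 < ζ := by
    rw [← hζt] at hη
    exact pos_of_mul_pos_left hη hθ.le
  have hc : 2 ≤ c := by linarith
  set θ := 1 / 2 - 1 / t with hθdef
  set η := 1 / t - 1 / c with hηdef
  have htend : Filter.Tendsto (fun n : ℕ => (n : ℝ) ^ θ) Filter.atTop Filter.atTop :=
    (tendsto_rpow_atTop hθ).comp tendsto_natCast_atTop_atTop
  obtain ⟨N₀, hN₀⟩ := Filter.eventually_atTop.mp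
    ((htend.eventually_ge_atTop (2 ^ M : ℝ)).and (Filter.eventually_ge_atTop 16))
  obtain ⟨κ, _, _, y, hN, hy, hE⟩ := exists_large_signAvg_le_of_not_hasCotype
    (by linarith) hts hs N₀
  obtain ⟨hNM, hN16⟩ := hN₀ _ hN
  set N := Fintype.card κ with hNdef
  have hN16' : (16 : ℝ) ≤ N := by exact_mod_cast hN16
  have hN0 : (0 : ℝ) < N := by linarith
  obtain ⟨R, hNR, hR⟩ := h.exists_subset_signAvg_le (K := 2 * C * (N : ℝ) ^ η) (by linarith)
    (by linarith) y hE (by positivity) (by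
      refine two_mul_rpow_le_rpow_mul (by linarith) (by positivity) (by positivity)
        (Nat.cast_nonneg _) (le_of_eq ?_)
      rw [mul_assoc (2 * C), ← Real.rpow_add hN0, hηdef]
      ring_nf)
  set b := Nat.log 2 ⌊(N : ℝ) ^ θ⌋₊ with hb
  have hfl : ⌊(N : ℝ) ^ θ⌋₊ ≠ 0 := by
    have : 2 ^ M ≤ ⌊(N : ℝ) ^ θ⌋₊ := Nat.le_floor (by exact_mod_cast hNM)
    have := Nat.two_pow_pos M
    omega
  have hMb : M ≤ b := Nat.le_log_of_pow_le one_lt_two (Nat.le_floor (by exact_mod_cast hNM))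
  have hb1 : (2 : ℝ) ^ b ≤ (N : ℝ) ^ θ := by
    have h1 := (Nat.le_floor_iff (by positivity)).mp (Nat.pow_log_le_self 2 hfl)
    exact_mod_cast h1
  have hb2 : (N : ℝ) ^ θ ≤ 2 * (2 : ℝ) ^ b := by
    have h1 := (Nat.floor_lt (by positivity)).mp (Nat.lt_pow_succ_log_self one_lt_two
      ⌊(N : ℝ) ^ θ⌋₊)
    rw [← hb] at h1
    push_cast [pow_succ] at h1
    linarith
  set a := Nat.log 2 R.card with ha
  have hR0 : R.card ≠ 0 := by omega
  have ha1 : 2 ^ a ≤ R.card := Nat.pow_log_le_self 2 hR0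
  have ha2 : (N : ℝ) ≤ 4 * 2 ^ a := by
    have h1 : R.card < 2 ^ (a + 1) := Nat.lt_pow_succ_log_self one_lt_two _
    have h2 : N ≤ 4 * 2 ^ a := by
      rw [pow_succ] at h1
      omega
    exact_mod_cast h2
  have hsqrt : √(N : ℝ) * √(N : ℝ) = N := Real.mul_self_sqrt hN0.le
  have hsqrt4 : 4 ≤ √(N : ℝ) := Real.le_sqrt_of_sq_le (by linarith)
  have hba : b ≤ a := by
    have h1 : (2 : ℝ) ^ b ≤ √N := by
      refine hb1.trans ?_
      rw [Real.sqrt_eq_rpow]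
      refine Real.rpow_le_rpow_of_exponent_le (by linarith) ?_
      have : 0 < 1 / t := by positivity
      linarith
    have h2 : (2 : ℝ) ^ b ≤ 2 ^ a := by nlinarith
    exact (pow_le_pow_iff_right₀ one_lt_two).mp h2
  obtain ⟨j, hj⟩ := Nat.exists_eq_add_of_le hba
  obtain ⟨g, -, -, hg⟩ := exists_injective_sum_abs_le hc (by positivity) hR
    (fun f hf => (sum_abs_le_sqrt_card_mul y f hf).trans
      (mul_le_mul_of_nonneg_left hE (Real.sqrt_nonneg _))) j b (hj ▸ ha1)
  refine ⟨b, hMb, fun i => y (g i), fun i => hy _, fun f hf => (hg f hf).trans ?_⟩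
  have hμ : (1 : ℝ) ≤ 2 ^ b := one_le_pow₀ one_le_two
  set μ : ℝ := 2 ^ b with hμdef
  have h1 : √(N : ℝ) * (N : ℝ) ^ (1 / t) / 2 ^ j ≤ 4 := by
    rw [div_le_iff₀ (by positivity)]
    have h2 : √(N : ℝ) * (N : ℝ) ^ (1 / t) * (N : ℝ) ^ θ = N := by
      rw [Real.sqrt_eq_rpow, ← Real.rpow_add hN0, ← Real.rpow_add hN0, hθdef]
      ring_nf
      exact Real.rpow_one _
    have h3 : √(N : ℝ) * (N : ℝ) ^ (1 / t) * μ ≤ N :=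
      (mul_le_mul_of_nonneg_left hb1 (by positivity)).trans_eq h2
    rw [hj, pow_add] at ha2
    have h4 : √(N : ℝ) * (N : ℝ) ^ (1 / t) * μ ≤ 4 * 2 ^ j * μ := by
      refine h3.trans (ha2.trans_eq ?_)
      ring
    exact le_of_mul_le_mul_right h4 (by linarith)
  have h2 : (N : ℝ) ^ η ≤ 2 * μ ^ ζ := by
    calc (N : ℝ) ^ η = ((N : ℝ) ^ θ) ^ ζ := by
          rw [← Real.rpow_mul hN0.le, mul_comm, hζt]
      _ ≤ (2 * μ) ^ ζ := by gcongr
      _ = 2 ^ ζ * μ ^ ζ := Real.mul_rpow (by positivity) (by positivity)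
      _ ≤ 2 * μ ^ ζ := by
        gcongr
        simpa using Real.rpow_le_rpow_of_exponent_le one_le_two hζ
  have h3 : 1 ≤ μ ^ (1 / c + ζ) := Real.one_le_rpow hμ (by positivity)
  have h4 : 4 * (2 * C * (N : ℝ) ^ η) * μ ^ (1 / c) ≤ 16 * C * μ ^ (1 / c + ζ) := by
    calc 4 * (2 * C * (N : ℝ) ^ η) * μ ^ (1 / c) ≤ 4 * (2 * C * (2 * μ ^ ζ)) * μ ^ (1 / c) := by
          gcongr
      _ = _ := by
        rw [Real.rpow_add (by positivity)]
        ring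
  nlinarith

lemma HasCotypeConst.exists_large_sum_abs_le (h : HasCotypeConst Y c C) (hC : 1 ≤ C) (ht : 2 < t)
    (hts : t < s) (hsc : s ≤ c) (hs : ¬HasCotype Y s) {ζ : ℝ} (hζ0 : 0 ≤ ζ) (hζ : ζ ≤ 1)
    (hζt : ζ * (1 / 2 - 1 / t) = 1 / t - 1 / c) (N : ℕ) :
    ∃ m : ℕ, N ≤ m ∧ ∃ w : Fin m → Y, (∀ i, 1 ≤ ‖w i‖) ∧
      ∀ A : Finset (Fin m), A.Nonempty → ∀ f : Y →L[ℝ] ℝ, ‖f‖ ≤ 1 →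
        ∑ i ∈ A, |f (w i)| ≤ 96 * C ^ 2 * (m : ℝ) ^ ζ * (A.card : ℝ) ^ (1 / c) := by
  obtain ⟨b, hb, w, hw, hS⟩ := h.exists_sum_abs_le hC ht hts hsc hs hζ hζt (2 * N)
  have hμ : (0 : ℝ) < 2 ^ b := by positivity
  obtain ⟨R, hR, hRS⟩ := h.exists_subset_sum_abs_le (K := 48 * C ^ 2 * ((2 : ℝ) ^ b) ^ ζ)
    (by linarith) (by linarith) w hS (by positivity) (by
      rw [Fintype.card_fin]
      push_cast
      refine two_mul_rpow_le_rpow_mul (by linarith) (by positivity) (by positivity) hμ.le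
        (le_of_eq ?_)
      rw [Real.rpow_add hμ]
      ring)
  rw [Fintype.card_fin] at hR
  let e : Fin R.card → Fin (2 ^ b) := fun i => (R.equivFin.symm i : Fin (2 ^ b))
  have he : Function.Injective e := Subtype.val_injective.comp (Equiv.injective _)
  refine ⟨R.card, ?_, fun i => w (e i), fun i => hw _, fun A hA f hf => ?_⟩
  · have : b < 2 ^ b := Nat.lt_two_pow_self
    omega
  have h1 := hRS (A.image e) (fun i hi => by
    obtain ⟨p, -, rfl⟩ := Finset.mem_image.mp hi
    exact Subtype.mem _) (hA.image _) f hf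
  rw [Finset.sum_image he.injOn, Finset.card_image_of_injective _ he] at h1
  refine h1.trans ?_
  have h2 : ((2 : ℝ) ^ b) ^ ζ ≤ 2 * (R.card : ℝ) ^ ζ := by
    calc ((2 : ℝ) ^ b) ^ ζ ≤ (2 * R.card : ℝ) ^ ζ := by
          gcongr
          exact_mod_cast hR
      _ = 2 ^ ζ * (R.card : ℝ) ^ ζ := Real.mul_rpow (by positivity) (by positivity)
      _ ≤ 2 * (R.card : ℝ) ^ ζ := by
        gcongr
        simpa using Real.rpow_le_rpow_of_exponent_le one_le_two hζ
  calc 48 * C ^ 2 * ((2 : ℝ) ^ b) ^ ζ * (A.card : ℝ) ^ (1 / c) ≤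
      48 * C ^ 2 * (2 * (R.card : ℝ) ^ ζ) * (A.card : ℝ) ^ (1 / c) := by gcongr
    _ = _ := by ring

end CotypeSpread

lemma sum_range_succ_rpow_neg_le {β : ℝ} (hβ0 : 0 ≤ β) (hβ1 : β < 1) (m : ℕ) :
    ∑ j ∈ Finset.range m, ((j + 1 : ℕ) : ℝ) ^ (-β) ≤ (m : ℝ) ^ (1 - β) / (1 - β) := by
  have hγ : 0 < 1 - β := sub_pos.mpr hβ1
  induction m with
  | zero => simp [Real.zero_rpow hγ.ne']
  | succ m ih =>
    rw [Finset.sum_range_succ]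
    have hm : (0 : ℝ) < (m + 1 : ℕ) := by positivity
    have h1 := rpow_one_add_le_one_add_mul_self (s := -(1 / ((m + 1 : ℕ) : ℝ)))
      (neg_le_neg ((div_le_one hm).mpr (by simp))) hγ.le (by linarith)
    have h2 : (m : ℝ) ^ (1 - β) =
        ((m + 1 : ℕ) : ℝ) ^ (1 - β) * (1 + -(1 / ((m + 1 : ℕ) : ℝ))) ^ (1 - β) := by
      have h3 : 1 + -(1 / ((m + 1 : ℕ) : ℝ)) = m / (m + 1 : ℕ) := by
        push_cast
        field_simp
        ring
      rw [h3, ← Real.mul_rpow hm.le (by positivity), mul_div_cancel₀ _ hm.ne']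
    have h4 : ((m + 1 : ℕ) : ℝ) ^ (-β) = ((m + 1 : ℕ) : ℝ) ^ (1 - β) * (1 / ((m + 1 : ℕ) : ℝ)) := by
      rw [mul_one_div, ← Real.rpow_sub_one hm.ne']
      ring_nf
    refine (add_le_add_left ih _).trans ?_
    rw [div_add' _ _ _ hγ.ne', div_le_div_iff_of_pos_right hγ, h2, h4]
    have h5 := mul_le_mul_of_nonneg_left h1 (Real.rpow_nonneg hm.le (1 - β))
    linarith

lemma norm_sum_smul_le_of_sum_abs_le {Y : Type*} [NormedAddCommGroup Y] [NormedSpace ℝ Y]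
    {c l s K : ℝ} (hs : 1 < s) (hsl : s < l) (hsc : s ≤ c) (hK : 0 ≤ K) {m : ℕ} (w : Fin m → Y)
    (h : ∀ A : Finset (Fin m), A.Nonempty → ∀ f : Y →L[ℝ] ℝ, ‖f‖ ≤ 1 →
        ∑ i ∈ A, |f (w i)| ≤ K * (A.card : ℝ) ^ (1 / c))
    (a : Fin m → ℝ) (ha : ∑ i, ‖a i‖ ^ l ≤ 1) :
    ‖∑ i, a i • w i‖ ≤
      K * ((1 / s - 1 / l) * l.conjExponent)⁻¹ ^ (1 / l.conjExponent) *
        (m : ℝ) ^ (1 / s - 1 / l) := by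
  have hconj : l.HolderConjugate l.conjExponent := .conjExponent (hs.trans hsl)
  set p := l.conjExponent
  have hp0 : 0 < p := hconj.symm.pos
  have hinv : 1 / l + 1 / p = 1 := by simpa using hconj.inv_add_inv_eq_one
  have hpos : 0 < 1 / s - 1 / l := sub_pos.mpr (one_div_lt_one_div_of_lt (by linarith) hsl)
  have hβ : 1 - p * (1 - 1 / s) = (1 / s - 1 / l) * p := by
    have : p * (1 / l + 1 / p) = p := by rw [hinv, mul_one]
    rw [mul_add, mul_one_div_cancel hp0.ne'] at this
    linarith
  have hs1 : 1 / s < 1 := (div_lt_one (by linarith)).mpr hs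
  obtain ⟨f, hf, hfa⟩ := exists_dual_vector'' ℝ (∑ i, a i • w i)
  have h1 : ∑ i, |f (w i)| ^ p ≤
      ∑ j ∈ Finset.range m, (K * ((j + 1 : ℕ) : ℝ) ^ (1 / s - 1)) ^ p := by
    refine Finset.sum_le_sum_range_of_forall_exists_le (f := fun i => |f (w i)| ^ p)
      (g := fun j => (K * (j : ℝ) ^ (1 / s - 1)) ^ p) m Finset.univ (by simp) fun A _ hA => ?_
    obtain ⟨i, hi, hmin⟩ := A.exists_min_image (fun i => |f (w i)|) hA
    refine ⟨i, hi, ?_⟩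
    have hA0 : (0 : ℝ) < A.card := by exact_mod_cast hA.card_pos
    have hA1 : (1 : ℝ) ≤ A.card := by exact_mod_cast hA.card_pos
    have h2 : A.card * |f (w i)| ≤ K * (A.card : ℝ) ^ (1 / s) := by
      calc A.card * |f (w i)| = ∑ k ∈ A, |f (w i)| := by simp
        _ ≤ ∑ k ∈ A, |f (w k)| := Finset.sum_le_sum hmin
        _ ≤ K * (A.card : ℝ) ^ (1 / c) := h A hA f hf
        _ ≤ K * (A.card : ℝ) ^ (1 / s) := by gcongr
    have h3 : |f (w i)| ≤ K * (A.card : ℝ) ^ (1 / s - 1) := by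
      rw [Real.rpow_sub_one hA0.ne', ← mul_div_assoc, le_div_iff₀ hA0, mul_comm]
      exact h2
    gcongr
  have h2 : ∑ i, |f (w i)| ^ p ≤
      K ^ p * ((m : ℝ) ^ ((1 / s - 1 / l) * p) / ((1 / s - 1 / l) * p)) := by
    refine h1.trans ?_
    have h3 (j : ℕ) : (K * ((j + 1 : ℕ) : ℝ) ^ (1 / s - 1)) ^ p =
        K ^ p * ((j + 1 : ℕ) : ℝ) ^ (-(p * (1 - 1 / s))) := by
      rw [Real.mul_rpow hK (by positivity), ← Real.rpow_mul (by positivity)]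
      ring_nf
    simp only [h3, ← Finset.mul_sum, ← hβ]
    refine mul_le_mul_of_nonneg_left (sum_range_succ_rpow_neg_le ?_ ?_ m) (by positivity)
    · exact mul_nonneg hp0.le (by linarith)
    · have := mul_pos hpos hp0
      linarith
  have h3 : ‖∑ i, a i • w i‖ = ∑ i, a i * f (w i) := by
    have h4 : f (∑ i, a i • w i) = ‖∑ i, a i • w i‖ := hfa
    rw [← h4]
    simp
  rw [h3]
  refine (Real.inner_le_Lp_mul_Lq _ _ _ hconj).trans ?_
  have hl0 : 0 < l := hconj.pos
  have h4 : (∑ i, |a i| ^ l) ^ (1 / l) ≤ 1 :=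
    Real.rpow_le_one (Finset.sum_nonneg fun i _ => by positivity) ha (by positivity)
  calc (∑ i, |a i| ^ l) ^ (1 / l) * (∑ i, |f (w i)| ^ p) ^ (1 / p) ≤
      1 * (K ^ p * ((m : ℝ) ^ ((1 / s - 1 / l) * p) / ((1 / s - 1 / l) * p))) ^ (1 / p) := by
        gcongr
    _ = _ := by
      have h5 : 0 ≤ ((1 / s - 1 / l) * p)⁻¹ := by positivity
      rw [one_mul, div_eq_mul_inv, Real.mul_rpow (by positivity) (by positivity),
        Real.mul_rpow (by positivity) h5, ← Real.rpow_mul hK, ← Real.rpow_mul (by positivity),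
        mul_assoc (1 / s - 1 / l), mul_one_div_cancel hp0.ne', Real.rpow_one, mul_one]
      ring

lemma hasFlatFamilies_of_two_le {Y : Type*} [NormedAddCommGroup Y] [NormedSpace ℝ Y]
    {c C q l : ℝ} (h : HasCotypeConst Y c C) (hs : ∀ s : ℝ, 2 ≤ s → s < c → ¬HasCotype Y s)
    (hq : 2 ≤ q) (hqc : q < c) (hql : q < l) : HasFlatFamilies ℝ Y q l := by
  have hC : HasCotypeConst Y c (max C 1) := fun κ _ _ y =>
    (h κ y).trans (mul_le_mul_of_nonneg_right (le_max_left _ _) (Real.sqrt_nonneg _))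
  have hC1 : 1 ≤ max C 1 := le_max_right _ _
  generalize max C 1 = D at hC hC1
  obtain ⟨σ, hqσ, hσ⟩ := exists_between (lt_min hql hqc)
  obtain ⟨hσl, hσc⟩ := lt_min_iff.mp hσ
  set δ := min 1 ((1 / q - 1 / σ) / 2) with hδ
  have hgap : 0 < 1 / q - 1 / σ := sub_pos.mpr (one_div_lt_one_div_of_lt (by linarith) hqσ)
  have hδ0 : 0 < δ := lt_min one_pos (by linarith)
  have hδ1 : δ ≤ 1 := min_le_left _ _
  have hδ2 : δ ≤ (1 / q - 1 / σ) / 2 := min_le_right _ _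
  have hΔ : 0 < 1 / 2 - 1 / c := sub_pos.mpr (one_div_lt_one_div_of_lt two_pos (by linarith))
  have hc0 : 0 < 1 / c := one_div_pos.mpr (by linarith)
  set t := 1 / (1 / c + (1 / 2 - 1 / c) * δ / 2) with ht
  have ht1 : 1 / t = 1 / c + (1 / 2 - 1 / c) * δ / 2 := by rw [ht, one_div_one_div]
  have hη : 0 < (1 / 2 - 1 / c) * δ / 2 := by positivity
  have ht0 : 0 < t := by positivity
  have h2t : 2 < t := by
    rw [← one_div_lt_one_div ht0 two_pos, ht1]
    nlinarith
  have htc : t < c := by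
    rw [← one_div_lt_one_div (by linarith) ht0, ht1]
    linarith
  obtain ⟨s, hts, hsc⟩ := exists_between htc
  have hζ1 : δ / (2 - δ) ≤ δ := div_le_self hδ0.le (by linarith)
  have hζ0 : 0 ≤ δ / (2 - δ) := div_nonneg hδ0.le (by linarith)
  set ζ := δ / (2 - δ) with hζ
  have hζt : ζ * (1 / 2 - 1 / t) = 1 / t - 1 / c := by
    have h1 : ζ * (2 - δ) = δ := div_mul_cancel₀ _ (by linarith)
    rw [ht1]
    linear_combination (1 / 2 - 1 / c) / 2 * h1
  have hσ0 : 0 < 1 / σ := one_div_pos.mpr (by linarith)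
  have hqs : q < 1 / (1 / σ + ζ) := by
    rw [lt_one_div (by linarith) (by linarith)]
    linarith
  refine .of_upper_estimate (by linarith) hqs
    (K := 96 * D ^ 2 * ((1 / σ - 1 / l) * l.conjExponent)⁻¹ ^ (1 / l.conjExponent)) fun N => ?_
  obtain ⟨m, hm, w, hw, hS⟩ := hC.exists_large_sum_abs_le hC1 h2t hts hsc.le
    (hs s (by linarith) hsc) hζ0 (hζ1.trans hδ1) hζt (max N 1)
  refine ⟨m, (le_max_left _ _).trans hm, w, hw, fun a ha => ?_⟩
  have hm0 : (0 : ℝ) < m := by exact_mod_cast (le_max_right _ _).trans hm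
  refine (norm_sum_smul_le_of_sum_abs_le (by linarith) hσl hσc.le (by positivity) w hS a ha).trans
    (le_of_eq ?_)
  rw [one_div_one_div, add_sub_right_comm, Real.rpow_add hm0]
  ring

lemma hasFlatFamilies_of_lt_min {𝕂 : Type*} [RCLike 𝕂] {Y : Type*} [NormedAddCommGroup Y]
    [NormedSpace 𝕂 Y] (hY : ¬FiniteDimensional 𝕂 Y) {c q l : ℝ} (hcot : HasCotype Y c)
    (hcmin : ∀ s : ℝ, 2 ≤ s → s < c → ¬HasCotype Y s) (hq : 0 < q) (hql : q < l) (hqc : q < c) :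
    HasFlatFamilies 𝕂 Y q l := by
  let _ : NormedSpace ℝ Y := NormedSpace.restrictScalars ℝ 𝕂 Y
  have : IsScalarTower ℝ 𝕂 Y := RestrictScalars.isScalarTower ℝ 𝕂 Y
  refine .of_real (hq.trans hql) ?_
  rcases lt_or_ge q 2 with hq2 | hq2
  · exact hasFlatFamilies_of_lt_two (fun h => hY (.right ℝ 𝕂 Y)) hq hq2 hql
  · obtain ⟨C, -, hC⟩ := hcot.exists_const ℝ
    exact hasFlatFamilies_of_two_le (C := C) hC hcmin hq2 hqc hql

/-- For `2 ≤ r_k < ∞` and `Y` infinite dimensional with cotype exactly `c = cot Y`, every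
continuous `(n₁,…,n_m)`-homogeneous polynomial from `ℓ_r₁ × ⋯ × ℓ_r_m` into `Y` is absolutely
`(q;1)`-summing iff `q ≥ min (1/(n₁/r₁ + ⋯ + n_m/r_m)) c`. -/
theorem stmt19 (𝕂 : Type*) [RCLike 𝕂] (m : ℕ) (hm : 0 < m) (n : Fin m → ℕ)
    (hn : ∀ k, 1 ≤ n k) (r : Fin m → ℝ) (hr : ∀ k, 2 ≤ r k)
    [hfact : ∀ k, Fact (1 ≤ ENNReal.ofReal (r k))]
    (Y : Type*) [NormedAddCommGroup Y] [NormedSpace 𝕂 Y] [CompleteSpace Y]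
    (hY : ¬FiniteDimensional 𝕂 Y)
    (c : ℝ) (hc2 : 2 ≤ c) (hcot : HasCotype Y c)
    (hcmin : ∀ s : ℝ, 2 ≤ s → s < c → ¬HasCotype Y s)
    (q : ℝ) (hq : 0 < q) :
    (∀ P : (∀ k, lp (fun _ : ℕ => 𝕂) (ENNReal.ofReal (r k))) → Y, IsMultiPoly 𝕂 n P →
      ∀ x : ∀ k, ℕ → lp (fun _ : ℕ => 𝕂) (ENNReal.ofReal (r k)),
        (∀ k, WeaklySummable 𝕂 (x k)) → Summable fun j => ‖P fun k => x k j‖ ^ q) ↔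
    min (1 / ∑ k, (n k : ℝ) / r k) c ≤ q := by

  have : Nonempty (Σ k, Fin (n k)) := ⟨⟨⟨0, hm⟩, ⟨0, hn _⟩⟩⟩
  have hr0 (k) : 0 < r k := by linarith [hr k]
  have hsum : ∑ i : Σ k, Fin (n k), 1 / r i.1 = ∑ k, (n k : ℝ) / r k := by
    rw [Fintype.sum_sigma]
    simp [div_eq_mul_inv]
  have hσ : 0 < ∑ k, (n k : ℝ) / r k := by
    rw [← hsum]
    exact Finset.sum_pos (fun i _ => one_div_pos.mpr (hr0 i.1)) Finset.univ_nonempty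
  set l := 1 / ∑ k, (n k : ℝ) / r k with hl
  have hl0 : 0 < l := one_div_pos.mpr hσ
  have hlr : ∑ i : Σ k, Fin (n k), l / r i.1 = 1 := by
    rw [← one_div_mul_cancel hσ.ne', ← hl, ← hsum, Finset.mul_sum]
    simp only [mul_one_div]
  constructor
  · intro H
    by_contra! hlt
    obtain ⟨hql, hqc⟩ := lt_min_iff.mp hlt
    obtain ⟨T, b, hb0, hb, hT⟩ := HasFlatFamilies.exists_not_summable
      (r := fun i : Σ k, Fin (n k) => r i.1) (fun i => by linarith [hr i.1]) hq hl0 hlr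
      (hasFlatFamilies_of_lt_min (𝕂 := 𝕂) hY hcot hcmin hq hql hqc)
    refine hT (H (fun z => T fun i => z i.1) ⟨T, fun z => rfl⟩
      (fun k j => lp.single (ENNReal.ofReal (r k)) j ((b j ^ (l / r k) : ℝ) : 𝕂)) fun k =>
        weaklySummable_single (by linarith [hr k]) ?_)
    convert hb using 2 with j
    rw [RCLike.norm_ofReal, abs_of_nonneg (Real.rpow_nonneg (hb0 j) _),
      ← Real.rpow_mul (hb0 j), div_mul_cancel₀ _ (hr0 k).ne']
  · rintro hq' P ⟨T, hT⟩ x hx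
    simp only [hT]
    rcases min_le_iff.mp hq' with h | h
    · exact (summable_multilinear_lp (fun i : Σ k, Fin (n k) => r i.1) (fun i => hr i.1) hl0 hlr T
        (fun i => x i.1) fun i => hx i.1).rpow_of_le (fun _ => norm_nonneg _) hl0 h
    · exact (hcot.summable_multilinear (by linarith) T (fun i => x i.1)
        fun i => hx i.1).rpow_of_le (fun _ => norm_nonneg _) (by linarith) h
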